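/- Assume k < n+1 and let w ∈ W^odd ∩ W^P with w(1) = 1. Then for every d ≥ 1 and every decomposition d_1 + d_2 = d − 1 with d_1, d_2 ≥ 0: (w · O_Y(d)) W_P = (((w · O_Z(d_1)) W_P · O_Y(1)) W_P ·_k O^∘(d_2)) W_P, where O_Y(d) := O_Y(1) ·_k O^∘(d−1). In particular the coset (w · O_Z(d_1) · O_Y(1) ·_k O^∘(d_2)) W_P is independent of the choice of d_1, d_2 with d_1 + d_2 = d − 1. -/

import Mathlib

/-!
Common framework: the Weyl group of type `C_{m+1}` realized as signed permutations
of `Fin (2*m+2)` (values 0-indexed: the paper's 1-indexed value `a ∈ {1, …, 2m+2}`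
corresponds to `a-1`, and the paper's `bar a = 2m+3-a` corresponds to `2m+2-a`).
For the odd symplectic Grassmannian `IG(k, 2n+1)` one takes `m = n`;
the smaller group `W_{2n}` of type `C_n` corresponds to `m = n-1`.
-/

namespace OddSymplectic

open Equiv

noncomputable section

/-- The element of `Fin (2*m+2)` with (0-indexed) value `i`. -/
def fn (m i : ℕ) : Fin (2*m+2) := ⟨i % (2*m+2), Nat.mod_lt _ (by omega)⟩

/-- The bar involution on values. -/
def bar (m : ℕ) (j : Fin (2*m+2)) : Fin (2*m+2) := ⟨2*m+1 - (j:ℕ), by omega⟩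

def barPerm (m : ℕ) : Equiv.Perm (Fin (2*m+2)) :=
  Function.Involutive.toPerm (bar m) (fun j => by
    have hj := j.isLt
    apply Fin.ext
    simp [bar]
    omega)

/-- The Weyl group of type `C_{m+1}`: the permutations of `Fin (2*m+2)` commuting with
the bar involution (signed permutations). -/
def Weyl (m : ℕ) : Subgroup (Equiv.Perm (Fin (2*m+2))) :=
  Subgroup.centralizer {barPerm m}

/-- The simple reflection `s_i`, `1 ≤ i ≤ m+1`. -/
def sRefl (m i : ℕ) : Equiv.Perm (Fin (2*m+2)) :=
  if i ≤ m then
    Equiv.swap (fn m (i-1)) (fn m i) * Equiv.swap (fn m (2*m+2-i)) (fn m (2*m+1-i))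
  else
    Equiv.swap (fn m m) (fn m (m+1))

/-- Coxeter length: the minimal length of an expression as a product of simple reflections. -/
def len (m : ℕ) (w : Equiv.Perm (Fin (2*m+2))) : ℕ :=
  sInf {r | ∃ l : List ℕ, l.length = r ∧ (∀ i ∈ l, 1 ≤ i ∧ i ≤ m+1) ∧
    (l.map (sRefl m)).prod = w}

/-- The set of reflections. -/
def reflections (m : ℕ) : Set (Equiv.Perm (Fin (2*m+2))) :=
  {t | ∃ u ∈ Weyl m, ∃ i, 1 ≤ i ∧ i ≤ m+1 ∧ t = u * sRefl m i * u⁻¹}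

/-- The Bruhat order. -/
def bruhatLE (m : ℕ) (u w : Equiv.Perm (Fin (2*m+2))) : Prop :=
  Relation.ReflTransGen (fun a b => ∃ t ∈ reflections m, b = a * t ∧ len m a < len m b) u w

/-- The parabolic subgroup `W_P` generated by the simple reflections `s_i`, `i ≠ kk`. -/
def WP (m kk : ℕ) : Subgroup (Equiv.Perm (Fin (2*m+2))) :=
  Subgroup.closure {x | ∃ i, 1 ≤ i ∧ i ≤ m+1 ∧ i ≠ kk ∧ x = sRefl m i}

/-- `x W_P = y W_P`. -/
def cosetEq (m kk : ℕ) (x y : Equiv.Perm (Fin (2*m+2))) : Prop := x⁻¹ * y ∈ WP m kk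

/-- `w ∈ W^P`: `w` is a minimal length representative of its coset `w W_P`. -/
def isMinRep (m kk : ℕ) (w : Equiv.Perm (Fin (2*m+2))) : Prop :=
  w ∈ Weyl m ∧ ∀ v ∈ WP m kk, len m w ≤ len m (w * v)

/-- `w ∈ W^{odd}`: `w(j) ≠ bar 1` for all `1 ≤ j ≤ m+1` (1-indexed positions). -/
def isOdd (m : ℕ) (w : Equiv.Perm (Fin (2*m+2))) : Prop :=
  ∀ j : Fin (2*m+2), (j:ℕ) ≤ m → w j ≠ fn m (2*m+1)

/-- `w ∈ W°`: odd symplectic permutations with `w(j) ≠ 1` for `1 ≤ j ≤ kk`. -/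
def isOpen (m kk : ℕ) (w : Equiv.Perm (Fin (2*m+2))) : Prop :=
  isOdd m w ∧ ∀ j : Fin (2*m+2), (j:ℕ) < kk → w j ≠ fn m 0

/-- `φ(u)`: the number of barred entries among the first `kk` values of `u`. -/
def phi (m kk : ℕ) (u : Equiv.Perm (Fin (2*m+2))) : ℕ :=
  (Finset.univ.filter (fun j : Fin (2*m+2) => (j:ℕ) < kk ∧ m+1 ≤ ((u j : ℕ)))).card

/-- The set of values of `w` on the first `kk` positions. -/
def valSet (m kk : ℕ) (w : Equiv.Perm (Fin (2*m+2))) : Finset (Fin (2*m+2)) :=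
  (Finset.univ.filter (fun j : Fin (2*m+2) => (j:ℕ) < kk)).image w

/-- The (1-indexed) absolute value `|x|` of a signed entry. -/
def absVal (m : ℕ) (x : Fin (2*m+2)) : ℕ :=
  if (x:ℕ) ≤ m then (x:ℕ)+1 else 2*m+2-(x:ℕ)

/-! ### Hecke products -/

def hStep (m : ℕ) (w : Equiv.Perm (Fin (2*m+2))) (i : ℕ) : Equiv.Perm (Fin (2*m+2)) :=
  if len m w < len m (w * sRefl m i) then w * sRefl m i else w

/-- Hecke product of `w` with the word `l` of simple reflections. -/
def hWord (m : ℕ) (w : Equiv.Perm (Fin (2*m+2))) (l : List ℕ) : Equiv.Perm (Fin (2*m+2)) :=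
  l.foldl (hStep m) w

def hStepK (m kk : ℕ) (w : Equiv.Perm (Fin (2*m+2))) (i : ℕ) : Equiv.Perm (Fin (2*m+2)) :=
  if len m w < len m (w * sRefl m i) ∨ i = kk then w * sRefl m i else w

/-- Modified Hecke product `·_k` of `w` with the word `l`. -/
def hWordK (m kk : ℕ) (w : Equiv.Perm (Fin (2*m+2))) (l : List ℕ) : Equiv.Perm (Fin (2*m+2)) :=
  l.foldl (hStepK m kk) w

/-- The list `[a, a+1, …, b]`. -/
def ascList (a b : ℕ) : List ℕ := List.range' a (b+1-a)

/-- The word `s_1 s_2 ⋯ s_{m+1} ⋯ s_2 s_1` for `O^∘(1)`. -/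
def wordOcirc1 (m : ℕ) : List ℕ := ascList 1 (m+1) ++ (ascList 1 m).reverse

/-- The word `s_1 ⋯ s_{kk-1} s_{kk+1} ⋯ s_{m+1} ⋯ s_2 s_1` for `O_Y(1)`. -/
def wordOY1 (m kk : ℕ) : List ℕ :=
  ascList 1 (kk-1) ++ ascList (kk+1) (m+1) ++ (ascList 1 m).reverse

/-- The word `s_2 ⋯ s_{m+1} ⋯ s_2` for `O_Z(1)`. -/
def wordOZ1 (m : ℕ) : List ℕ := ascList 2 (m+1) ++ (ascList 2 m).reverse

def wordOcirc (m d : ℕ) : List ℕ := (List.replicate d (wordOcirc1 m)).flatten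
def wordOZ (m d : ℕ) : List ℕ := (List.replicate d (wordOZ1 m)).flatten

/-- `w ·_k O^∘(d)`. -/
def mulOcirc (m kk : ℕ) (w : Equiv.Perm (Fin (2*m+2))) (d : ℕ) : Equiv.Perm (Fin (2*m+2)) :=
  hWordK m kk w (wordOcirc m d)

/-- `w · O_Z(d)`. -/
def mulOZ (m : ℕ) (w : Equiv.Perm (Fin (2*m+2))) (d : ℕ) : Equiv.Perm (Fin (2*m+2)) :=
  hWord m w (wordOZ m d)

/-- `w · O_Y(1)`. -/
def mulOY1 (m kk : ℕ) (w : Equiv.Perm (Fin (2*m+2))) : Equiv.Perm (Fin (2*m+2)) :=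
  hWord m w (wordOY1 m kk)

/-- `w · O_Y(d) = (w · O_Y(1)) ·_k O^∘(d-1)`. -/
def mulOY (m kk : ℕ) (w : Equiv.Perm (Fin (2*m+2))) (d : ℕ) : Equiv.Perm (Fin (2*m+2)) :=
  mulOcirc m kk (mulOY1 m kk w) (d-1)

/-! ### Positive roots of type `C_{m+1}` -/

/-- Positive roots of type `C_{m+1}` (1-indexed `i < j ≤ m+1`). -/
inductive PosRoot : Type
  | tm (i j : ℕ)   -- `t_i - t_j`
  | tp (i j : ℕ)   -- `t_i + t_j`
  | lg (i : ℕ)     -- `2 t_i`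

def PosRoot.valid (m : ℕ) : PosRoot → Prop
  | .tm i j => 1 ≤ i ∧ i < j ∧ j ≤ m+1
  | .tp i j => 1 ≤ i ∧ i < j ∧ j ≤ m+1
  | .lg i => 1 ≤ i ∧ i ≤ m+1

/-- The reflection `s_α`. -/
def PosRoot.refl (m : ℕ) : PosRoot → Equiv.Perm (Fin (2*m+2))
  | .tm i j => Equiv.swap (fn m (i-1)) (fn m (j-1)) *
      Equiv.swap (fn m (2*m+2-i)) (fn m (2*m+2-j))
  | .tp i j => Equiv.swap (fn m (i-1)) (fn m (2*m+2-j)) *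
      Equiv.swap (fn m (j-1)) (fn m (2*m+2-i))
  | .lg i => Equiv.swap (fn m (i-1)) (fn m (2*m+2-i))

/-- The coefficient of the simple root `α_kk` in the expansion of `α` in simple roots. -/
def PosRoot.rootCoeff (m kk : ℕ) : PosRoot → ℕ
  | .tm i j => if i ≤ kk ∧ kk < j then 1 else 0
  | .tp i j => if i ≤ kk ∧ kk < j then 1 else if j ≤ kk ∧ kk ≤ m then 2
      else if j ≤ kk then 1 else 0
  | .lg i => if i ≤ kk ∧ kk ≤ m then 2 else if i ≤ kk then 1 else 0

/-- The coefficient of the simple coroot `α_kk^∨` in the expansion of `α^∨` in simple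
coroots: the degree of the corresponding edge of the moment graph. -/
def PosRoot.corootCoeff (kk : ℕ) : PosRoot → ℕ
  | .tm i j => if i ≤ kk ∧ kk < j then 1 else 0
  | .tp i j => if i ≤ kk ∧ kk < j then 1 else if j ≤ kk then 2 else 0
  | .lg i => if i ≤ kk then 1 else 0

/-- `α ∈ R_1^+`. -/
def PosRoot.inR1 (m kk : ℕ) : PosRoot → Bool
  | .tm i j => decide (1 ≤ i ∧ i ≤ kk ∧ kk < j ∧ j ≤ m+1)
  | .tp i j => decide (1 ≤ i ∧ i ≤ kk ∧ kk < j ∧ j ≤ m+1)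
  | .lg i => decide (1 ≤ i ∧ i ≤ kk)

/-- `α ∈ R_2^+`. -/
def PosRoot.inR2 (kk : ℕ) : PosRoot → Bool
  | .tp i j => decide (1 ≤ i ∧ i < j ∧ j ≤ kk)
  | _ => false

/-- Chains in the moment graph of `IG(kk, 2m+2)`, recorded with their list of roots:
each step goes from the vertex `u W_P` to the vertex with minimal length representative
`v`, where `v W_P = u s_α W_P` and `α ∈ R^+ \ R_P^+`. -/
inductive Chain (m kk : ℕ) :
    Equiv.Perm (Fin (2*m+2)) → Equiv.Perm (Fin (2*m+2)) → List PosRoot → Prop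
  | nil (u : Equiv.Perm (Fin (2*m+2))) : Chain m kk u u []
  | cons {u w : Equiv.Perm (Fin (2*m+2))} {l : List PosRoot}
      (a : PosRoot) (v : Equiv.Perm (Fin (2*m+2))) :
      a.valid m → a.rootCoeff m kk ≠ 0 → isMinRep m kk v →
      cosetEq m kk v (u * a.refl m) → Chain m kk v w l → Chain m kk u w (a :: l)

/-- The degree of a chain: the sum of the degrees of its edges. -/
def chainDeg (kk : ℕ) (l : List PosRoot) : ℕ := (l.map (PosRoot.corootCoeff kk)).sum

/-- Chains of a given total degree in the moment graph of `IG(kk, 2m+1)`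
(the full subgraph of the moment graph of `IG(kk, 2m+2)` on `W^P ∩ W^{odd}`). -/
inductive ChainO (m kk : ℕ) :
    Equiv.Perm (Fin (2*m+2)) → Equiv.Perm (Fin (2*m+2)) → ℕ → Prop
  | nil (u : Equiv.Perm (Fin (2*m+2))) : ChainO m kk u u 0
  | cons {u w : Equiv.Perm (Fin (2*m+2))} {d : ℕ}
      (a : PosRoot) (v : Equiv.Perm (Fin (2*m+2))) :
      a.valid m → a.rootCoeff m kk ≠ 0 → isMinRep m kk v → isOdd m v →
      cosetEq m kk v (u * a.refl m) → ChainO m kk v w d →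
      ChainO m kk u w (a.corootCoeff kk + d)

/-! ### The maps `Φ`, `Φ_Z`, `ψ` -/

/-- The relation `Φ(w W_P) = w' W_Y`, for `w` in the type `C_{n+1}` group and `w'` in the
type `C_n` group (entrywise shift of the first `kk` values). -/
def PhiRel (n kk : ℕ) (w : Equiv.Perm (Fin (2*n+2)))
    (w' : Equiv.Perm (Fin (2*(n-1)+2))) : Prop :=
  ∀ j, j < kk → ((w' (fn (n-1) j) : ℕ) + 1 = (w (fn n j) : ℕ))

/-- The relation `Φ_Z(w W_P) = w' W_Z` (entrywise shift of the values in positions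
`2, …, kk`). -/
def PhiZRel (n kk : ℕ) (w : Equiv.Perm (Fin (2*n+2)))
    (w' : Equiv.Perm (Fin (2*(n-1)+2))) : Prop :=
  ∀ j, j + 1 < kk → ((w' (fn (n-1) j) : ℕ) + 1 = (w (fn n (j+1)) : ℕ))

/-- The word `ψ(s_i)`. -/
def psiWord (kk i : ℕ) : List ℕ :=
  if i ≤ kk-1 then [i] else if i = kk then [kk, kk+1, kk] else [i+1]

/-- `j ↦ min({2,…,m+1} \ {|w(p)|, …, |w(kk)|})` (1-indexed positions `p ≤ j ≤ kk`). -/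
def jmin (m kk p : ℕ) (w : Equiv.Perm (Fin (2*m+2))) : ℕ :=
  sInf {i | 2 ≤ i ∧ i ≤ m+1 ∧ ∀ j, p ≤ j → j ≤ kk → absVal m (w (fn m (j-1))) ≠ i}

/-! ### Partitions -/

/-- `μ ∈ Part(k, N)`, encoded as a function `ℕ → ℤ` supported on `{1, …, k}`. -/
def IsPart (k N : ℕ) (μ : ℕ → ℤ) : Prop :=
  (∀ j, 1 ≤ j → j < k → μ (j+1) ≤ μ j) ∧ μ 1 ≤ (N:ℤ) - k ∧
  (∀ j, 1 ≤ j → j ≤ k → 0 ≤ μ j) ∧ (∀ j, j = 0 ∨ k < j → μ j = 0)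

/-- `D(μ)(i)`: the `i`-th step of the boundary path of the Young diagram of `μ` inside
the `k × (N-k)` rectangle (from northeast to southwest) is vertical. -/
def Dword (k N : ℕ) (μ : ℕ → ℤ) (i : ℕ) : Prop :=
  ∃ j, 1 ≤ j ∧ j ≤ k ∧ (i:ℤ) = (N:ℤ) - k - μ j + j

/-- `μ ∈ BC(k, 2n+2)`. -/
def IsBCeven (n k : ℕ) (μ : ℕ → ℤ) : Prop :=
  IsPart k (2*n+2) μ ∧
  ∀ i, 1 ≤ i → i ≤ n+1 → ¬(Dword k (2*n+2) μ i ∧ Dword k (2*n+2) μ (2*n+3-i))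

/-- `λ + 1^k`. -/
def addOne (k : ℕ) (lam : ℕ → ℤ) (j : ℕ) : ℤ := if 1 ≤ j ∧ j ≤ k then lam j + 1 else 0

/-- `λ ∈ BC(k, 2n+1)`: `λ ∈ Part(k, 2n+1)` and `λ + 1^k ∈ BC(k, 2n+2)`. -/
def IsBCodd (n k : ℕ) (lam : ℕ → ℤ) : Prop :=
  IsPart k (2*n+1) lam ∧ IsBCeven n k (addOne k lam)

/-- `β ∈ BKT(k, 2n+2)`: `(n+1-k)`-strict partitions. -/
def IsBKTeven (n k : ℕ) (β : ℕ → ℤ) : Prop :=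
  IsPart k (2*n+2) β ∧ ∀ j, 1 ≤ j → j < k → ((n:ℤ)+1-k < β j → β (j+1) < β j)

/-- `α ∈ BKT(k, 2n+1)`: `α = β - 1^k` with `β ∈ BKT(k, 2n+2)`. -/
def IsBKTodd (n k : ℕ) (α : ℕ → ℤ) : Prop :=
  IsBKTeven n k (addOne k α) ∧ (∀ j, j = 0 ∨ k < j → α j = 0)

/-- `ℓ(λ)`: the number of nonzero parts. -/
def numParts (k : ℕ) (lam : ℕ → ℤ) : ℕ :=
  ((Finset.Icc 1 k).filter (fun j => lam j ≠ 0)).card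

/-- `ℓ_i^d(λ) = #{j > d : λ_j > i}`. -/
def elld (k : ℕ) (lam : ℕ → ℤ) (i : ℤ) (d : ℕ) : ℕ :=
  ((Finset.Icc 1 k).filter (fun j => d < j ∧ i < lam j)).card

/-- `λ^{O∘(1)} = (λ_2-1, …, λ_{ℓ(λ)}-1, 0, …, 0)`. -/
def Oc1 (k : ℕ) (lam : ℕ → ℤ) (j : ℕ) : ℤ :=
  if 1 ≤ j ∧ j + 1 ≤ numParts k lam then lam (j+1) - 1 else 0

/-- `λ^{O∘(d)}`. -/
def OcD (k : ℕ) (lam : ℕ → ℤ) : ℕ → ℕ → ℤ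
  | 0 => lam
  | d+1 => Oc1 k (OcD k lam d)

/-- `λ^{O_Z(1)} = (λ_1, λ_3-1, …, λ_{ℓ(λ)}-1, 0, …, 0)` for `λ ∈ BC(k, 2n+1)`. -/
def OZ1 (k : ℕ) (lam : ℕ → ℤ) (j : ℕ) : ℤ :=
  if j = 1 then lam 1
  else if 2 ≤ j ∧ j + 1 ≤ numParts k lam then lam (j+1) - 1
  else 0

/-- `λ^{O_Z(d)}`. -/
def OZd (k : ℕ) (lam : ℕ → ℤ) : ℕ → ℕ → ℤ
  | 0 => lam
  | d+1 => OZ1 k (OZd k lam d)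

/-- `Comp_BC(d)`. -/
def CompBC (n k d : ℕ) (lam : ℕ → ℤ) : Prop :=
  IsBCodd n k lam ∧ lam 1 = 2*(n:ℤ)+1-k ∧
  lam (d+1) - (elld k lam ((d:ℤ)-1) (d+1) : ℤ) - d = 2*((n:ℤ)+1-k)

/-- The transposed partition. -/
def transpose (k : ℕ) (μ : ℕ → ℤ) (j : ℕ) : ℤ :=
  if 1 ≤ j then (((Finset.Icc 1 k).filter (fun i => (j:ℤ) ≤ μ i)).card : ℤ) else 0

/-- `D(μ)(i) = D(μ^t)(i)`. -/
def wingAgree (n k : ℕ) (μ : ℕ → ℤ) (i : ℕ) : Prop :=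
  Dword k (2*n+2) μ i ↔ Dword (2*n+2-k) (2*n+2) (transpose k μ) i

/-- `μ ∈ Part(k, 2n+2)` is `m`-wingtip symmetric. -/
def isWingtipEven (n k : ℕ) (μ : ℕ → ℤ) (m : ℕ) : Prop :=
  (∀ i, 1 ≤ i → i ≤ m → wingAgree n k μ i) ∧ (m = 2*n+2 ∨ ¬ wingAgree n k μ (m+1))

/-- `λ ∈ BC(k, 2n+1)` is `m`-wingtip symmetric. -/
def isWingtip (n k : ℕ) (lam : ℕ → ℤ) (m : ℕ) : Prop :=
  isWingtipEven n k (addOne k lam) m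

open scoped Classical in
/-- `λ^{O_Y(1)}` for an `m`-wingtip symmetric `λ ∈ BC(k, 2n+1)` with `λ_1 = 2n+1-k`. -/
def OY1 (n k m : ℕ) (lam : ℕ → ℤ) : ℕ → ℤ :=
  -- the step of `D(λ)` at position `bar m = 2n+3-m`
  let s := 2*n+3-m
  -- the row at (or just above) the step at position `s`
  let i := ((Finset.Icc 1 s).filter (fun t => Dword k (2*n+2) (addOne k lam) t)).card
  -- the column of the step at position `s` (when horizontal)
  let j := (2*n+2-k) + 1 -
    ((Finset.Icc 1 s).filter (fun t => ¬ Dword k (2*n+2) (addOne k lam) t)).card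
  if Dword k (2*n+2) (addOne k lam) s then
    -- `D(λ)(bar m) = 1` is the `i`-th 1: `(λ_2-1, …, λ_{i-1}-1, λ_i, λ_i, λ_{i+1}, …, λ_k)`
    fun p =>
      if 1 ≤ p ∧ p + 2 ≤ i then lam (p+1) - 1
      else if (p = i - 1 ∨ p = i) ∧ 1 ≤ p ∧ p ≤ k then lam i
      else if i + 1 ≤ p ∧ p ≤ k then lam p
      else 0
  else
    -- horizontal step at the bottom of row `i`, column `j`:
    -- `(λ_2-1, …, λ_i-1, j, λ_{i+1}, …, λ_k)`
    fun p =>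
      if 1 ≤ p ∧ p + 1 ≤ i then lam (p+1) - 1
      else if p = i ∧ 1 ≤ p ∧ p ≤ k then (j:ℤ)
      else if i + 1 ≤ p ∧ p ≤ k then lam p
      else 0

/-- `λ^{O_Y(d)} = (λ^{O_Y(1)})^{O∘(d-1)}`. -/
def OYd (n k m : ℕ) (lam : ℕ → ℤ) (d : ℕ) : ℕ → ℤ := OcD k (OY1 n k m lam) (d-1)

open scoped Classical in
/-- `α^{O_Z(1)}` for `α ∈ BKT(k, 2n+1)` with `α_1 = 2n+1-k`. -/
def OZ1bkt (n k : ℕ) (α : ℕ → ℤ) : ℕ → ℤ :=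
  if ∃ j, 3 ≤ j ∧ j ≤ k ∧ α 2 + α j ≤ 2*((n:ℤ)-k)+j-2 then
    -- `j0` minimal such that `α_2 + α_{j0} ≤ 2(n-k)+j0-2`
    let j0 := sInf {j | 3 ≤ j ∧ j ≤ k ∧ α 2 + α j ≤ 2*((n:ℤ)-k)+j-2}
    fun p =>
      if p = 1 then α 1
      else if 2 ≤ p ∧ p + 2 ≤ j0 then α (p+1)
      else if j0 ≤ p + 1 ∧ p + 1 ≤ k then max (α (p+1) - 1) (-1)
      else if p = k then -1 else 0
  else
    fun p =>
      if p = 1 then α 1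
      else if 2 ≤ p ∧ p + 1 ≤ k then α (p+1)
      else if p = k then -1 else 0

/-- `α^{O_Z(d)}`. -/
def OZdbkt (n k : ℕ) (α : ℕ → ℤ) : ℕ → ℕ → ℤ
  | 0 => α
  | d+1 => OZ1bkt n k (OZdbkt n k α d)

/-- `Comp_BKT(d)`. -/
def CompBKT (n k d : ℕ) (α : ℕ → ℤ) : Prop :=
  IsBKTodd n k α ∧ α 1 = 2*(n:ℤ)+1-k ∧
  (OZdbkt n k α (d-1)) 2 - (elld k (OZdbkt n k α (d-1)) (-1) 2 : ℤ) = 2*((n:ℤ)+1-k)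

/-- `ℓ_{-1}(α) = max {j : α_j > -1}`. -/
def ellNeg (k : ℕ) (α : ℕ → ℤ) : ℕ :=
  ((Finset.Icc 1 k).filter (fun j => (-1:ℤ) < α j)).sup id

/-- `α^{O_Y(1)} = (α_2, …, α_{ℓ_{-1}(α)}, 0, …, 0)` for `α ∈ BKT(k, 2n+1)` with
`α_1 = 2n+1-k`. -/
def OY1bkt (k : ℕ) (α : ℕ → ℤ) (j : ℕ) : ℤ :=
  if 1 ≤ j ∧ j + 1 ≤ ellNeg k α then α (j+1) else 0

/-! ### Correspondences between partitions and Weyl group elements -/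

/-- The 01-word correspondence between `μ ∈ BC(k, 2n+2)` and `w ∈ W^P`: for a 1-indexed
value `a ∈ {1, …, n+1}`, `a` occurs among the first `k` values of `w` iff `D(μ)(a) = 1`,
and `bar a` occurs iff `D(μ)(2n+3-a) = 1`. -/
def BCrel (n k : ℕ) (μ : ℕ → ℤ) (w : Equiv.Perm (Fin (2*n+2))) : Prop :=
  ∀ i, 1 ≤ i → i ≤ n+1 →
    ((fn n (i-1) ∈ valSet n k w) ↔ Dword k (2*n+2) μ i) ∧
    ((fn n (2*n+2-i) ∈ valSet n k w) ↔ Dword k (2*n+2) μ (2*n+3-i))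

/-- The BKT correspondence between `β ∈ BKT(k, 2n+2)` and `w ∈ W^P`:
`β_j = 2n+3-k-w(j) + #{i < j : w(i)+w(j) > 2n+3}` (1-indexed values). -/
def BKTrel (n k : ℕ) (β : ℕ → ℤ) (w : Equiv.Perm (Fin (2*n+2))) : Prop :=
  ∀ j, 1 ≤ j → j ≤ k →
    β j = 2*(n:ℤ)+3-k - ((w (fn n (j-1)) : ℕ) + 1) +
      (((Finset.Icc 1 (j-1)).filter
        (fun i => 2*n+1 < (w (fn n (i-1)) : ℕ) + (w (fn n (j-1)) : ℕ))).card : ℤ)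

/-! ### Windows of signed permutations -/

lemma fn_val {m i : ℕ} (h : i < 2*m+2) : (fn m i : ℕ) = i := Nat.mod_eq_of_lt h

lemma bar_val {m : ℕ} (j : Fin (2*m+2)) : (bar m j : ℕ) = 2*m+1 - (j:ℕ) := rfl

lemma fn_coe {m : ℕ} (p : Fin (2*m+2)) : fn m p = p := Fin.ext (fn_val p.isLt)

lemma mem_Weyl {m : ℕ} {w : Perm (Fin (2*m+2))} :
    w ∈ Weyl m ↔ ∀ p, w (bar m p) = bar m (w p) := by
  rw [Weyl, Subgroup.mem_centralizer_singleton_iff, Equiv.ext_iff]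
  rfl

/-- The value `w(p)` as a natural number (0-indexed). -/
def val (m : ℕ) (w : Perm (Fin (2*m+2))) (p : ℕ) : ℕ := (w (fn m p) : ℕ)

lemma val_lt {m : ℕ} (w : Perm (Fin (2*m+2))) (p : ℕ) : val m w p < 2*m+2 := (w _).isLt

lemma val_bar {m : ℕ} {w : Perm (Fin (2*m+2))} (hw : w ∈ Weyl m) {p : ℕ} (hp : p ≤ 2*m+1) :
    val m w (2*m+1-p) = 2*m+1 - val m w p := by
  have h := mem_Weyl.1 hw (fn m p)
  have e : bar m (fn m p) = fn m (2*m+1-p) := by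
    apply Fin.ext; rw [bar_val, fn_val (by omega), fn_val (by omega)]
  rw [e] at h
  simp only [val, h, bar_val]

lemma val_inj {m : ℕ} {w : Perm (Fin (2*m+2))} {p q : ℕ} (hp : p ≤ 2*m+1) (hq : q ≤ 2*m+1)
    (h : val m w p = val m w q) : p = q := by
  have := congrArg (fun x : Fin (2*m+2) => (x:ℕ)) (w.injective (Fin.ext h))
  simpa [fn_val (show p < 2*m+2 by omega), fn_val (show q < 2*m+2 by omega)] using this

lemma exists_val {m : ℕ} (w : Perm (Fin (2*m+2))) {x : ℕ} (hx : x ≤ 2*m+1) :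
    ∃ p ≤ 2*m+1, val m w p = x := by
  refine ⟨(w.symm (fn m x) : ℕ), by omega, ?_⟩
  rw [val, fn_coe, Equiv.apply_symm_apply, fn_val (by omega)]

/-- The simple reflection `s_i` on positions. -/
def sIdx (m i p : ℕ) : ℕ :=
  if p = i-1 then i else if p = i then i-1 else if p = 2*m+2-i then 2*m+1-i
    else if p = 2*m+1-i then 2*m+2-i else p

lemma sRefl_val {m i : ℕ} (h1 : 1 ≤ i) (h2 : i ≤ m+1) (p : Fin (2*m+2)) :
    (sRefl m i p : ℕ) = sIdx m i p := by
  have hp := p.isLt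
  have a1 := fn_val (show i-1 < 2*m+2 by omega)
  have a2 := fn_val (show i < 2*m+2 by omega)
  have a3 := fn_val (show 2*m+2-i < 2*m+2 by omega)
  have a4 := fn_val (show 2*m+1-i < 2*m+2 by omega)
  have a5 := fn_val (show m < 2*m+2 by omega)
  have a6 := fn_val (show m+1 < 2*m+2 by omega)
  unfold sRefl sIdx
  split_ifs <;> simp only [Perm.mul_apply, Equiv.swap_apply_def, Fin.ext_iff] <;>
    split_ifs <;> omega

lemma sIdx_lt {m i p : ℕ} (h1 : 1 ≤ i) (h2 : i ≤ m+1) (hp : p < 2*m+2) :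
    sIdx m i p < 2*m+2 := by
  unfold sIdx; split_ifs <;> omega

lemma sIdx_bar {m i p : ℕ} (h1 : 1 ≤ i) (h2 : i ≤ m+1) (hp : p < 2*m+2) :
    sIdx m i (2*m+1-p) = 2*m+1 - sIdx m i p := by
  unfold sIdx; split_ifs <;> omega

lemma sIdx_sIdx {m i p : ℕ} (h1 : 1 ≤ i) (h2 : i ≤ m+1) :
    sIdx m i (sIdx m i p) = p := by
  unfold sIdx; split_ifs <;> omega

lemma sRefl_mem {m i : ℕ} (h1 : 1 ≤ i) (h2 : i ≤ m+1) : sRefl m i ∈ Weyl m := by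
  rw [mem_Weyl]
  intro p
  apply Fin.ext
  rw [bar_val, sRefl_val h1 h2, sRefl_val h1 h2, bar_val, sIdx_bar h1 h2 p.isLt]

lemma sRefl_mul_self {m i : ℕ} (h1 : 1 ≤ i) (h2 : i ≤ m+1) : sRefl m i * sRefl m i = 1 := by
  ext p
  rw [Perm.mul_apply, sRefl_val h1 h2, sRefl_val h1 h2, sIdx_sIdx h1 h2]
  rfl

lemma val_mul_sRefl {m i : ℕ} (h1 : 1 ≤ i) (h2 : i ≤ m+1) (w : Perm (Fin (2*m+2))) {p : ℕ}
    (hp : p ≤ 2*m+1) : val m (w * sRefl m i) p = val m w (sIdx m i p) := by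
  have : sRefl m i (fn m p) = fn m (sIdx m i p) := by
    apply Fin.ext
    rw [sRefl_val h1 h2, fn_val (by omega), fn_val (sIdx_lt h1 h2 (by omega))]
  rw [val, Perm.mul_apply, this, val]

/-! ### Length and inversions -/

/-- The weighted inversion count, which is twice the Coxeter length. -/
def invCount (m : ℕ) (w : Perm (Fin (2*m+2))) : ℕ :=
  ∑ x : Fin (2*m+2) × Fin (2*m+2),
    if x.1 < x.2 ∧ w x.2 < w x.1 then (if x.2 = bar m x.1 then 2 else 1) else 0

lemma invCount_one (m : ℕ) : invCount m 1 = 0 := by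
  apply Finset.sum_eq_zero
  rintro ⟨p, q⟩ -
  rw [if_neg]
  simp only [Perm.one_apply]
  omega

lemma invCount_mul_of_lt {m i : ℕ} (h1 : 1 ≤ i) (h2 : i ≤ m+1) {w : Perm (Fin (2*m+2))}
    (hw : w ∈ Weyl m) (h : val m w (i-1) < val m w i) :
    invCount m (w * sRefl m i) = invCount m w + 2 := by
  set s := sRefl m i with hs
  have hss : ∀ p, s (s p) = p := fun p => by
    rw [← Perm.mul_apply, hs, sRefl_mul_self h1 h2]; rfl
  have hbar : ∀ p q, (s q = bar m (s p)) ↔ q = bar m p := fun p q => by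
    rw [← mem_Weyl.1 (sRefl_mem h1 h2), s.injective.eq_iff]
  have h' : val m w (2*m+1-i) < val m w (2*m+1-(i-1)) := by
    rw [val_bar hw (by omega), val_bar hw (by omega)]
    have := val_lt w i
    omega
  have key : ∀ x : Fin (2*m+2) × Fin (2*m+2),
      (if s x.1 < s x.2 ∧ w x.2 < w x.1 then (if x.2 = bar m x.1 then 2 else 1) else 0) =
      (if x.1 < x.2 ∧ w x.2 < w x.1 then (if x.2 = bar m x.1 then 2 else 1) else 0) +
      ((if x = (fn m i, fn m (i-1)) then 1 else 0) +
       (if x = (fn m (2*m+1-(i-1)), fn m (2*m+1-i)) then 1 else 0)) := by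
    rintro ⟨p, q⟩
    have e1 : ∀ j < 2*m+2, ∀ p : Fin (2*m+2), p = fn m j ↔ (p:ℕ) = j := fun j hj p => by
      rw [Fin.ext_iff, fn_val hj]
    simp only [Prod.mk.injEq, e1 i (by omega), e1 (i-1) (by omega),
      e1 (2*m+1-i) (by omega), e1 (2*m+1-(i-1)) (by omega)]
    have hwp : (w p : ℕ) = val m w p := by rw [val, fn_coe]
    have hwq : (w q : ℕ) = val m w q := by rw [val, fn_coe]
    have hp := p.isLt
    have hq := q.isLt
    simp only [Fin.lt_def, Fin.ext_iff, bar_val, hs, sRefl_val h1 h2, hwp, hwq]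
    generalize (p:ℕ) = a at *
    generalize (q:ℕ) = b at *
    by_cases c1 : a = i ∧ b = i-1
    · obtain ⟨rfl, rfl⟩ := c1
      have : sIdx m a a < sIdx m a (a-1) := by unfold sIdx; split_ifs <;> omega
      simp only [this, h, true_and, if_true]
      split_ifs <;> omega
    by_cases c2 : a = 2*m+1-(i-1) ∧ b = 2*m+1-i
    · obtain ⟨rfl, rfl⟩ := c2
      have : sIdx m i (2*m+1-(i-1)) < sIdx m i (2*m+1-i) := by
        unfold sIdx; split_ifs <;> omega
      simp only [this, h', true_and, if_true]
      split_ifs <;> omega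
    simp only [c1, c2, if_false, add_zero]
    by_cases c3 : val m w b < val m w a
    · have : sIdx m i a < sIdx m i b ↔ a < b := by
        have c4 : ¬ (a = i-1 ∧ b = i) := by rintro ⟨rfl, rfl⟩; omega
        have c5 : ¬ (a = 2*m+1-i ∧ b = 2*m+1-(i-1)) := by rintro ⟨rfl, rfl⟩; omega
        unfold sIdx; split_ifs <;> omega
      simp only [this]
    · simp only [c3, and_false, if_false]
  unfold invCount
  rw [← Equiv.sum_comp (s.prodCongr s)]
  have : ∀ x : Fin (2*m+2) × Fin (2*m+2),
      (if (s.prodCongr s x).1 < (s.prodCongr s x).2 ∧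
        (w * s) (s.prodCongr s x).2 < (w * s) (s.prodCongr s x).1 then
        (if (s.prodCongr s x).2 = bar m (s.prodCongr s x).1 then 2 else 1) else 0) =
      (if s x.1 < s x.2 ∧ w x.2 < w x.1 then (if x.2 = bar m x.1 then 2 else 1) else 0) := by
    rintro ⟨p, q⟩
    simp only [Equiv.prodCongr_apply, Prod.map, Perm.mul_apply, hss, hbar]
  simp only [this, key, Finset.sum_add_distrib, Finset.sum_ite_eq', Finset.mem_univ, if_true]

lemma invCount_mul_of_gt {m i : ℕ} (h1 : 1 ≤ i) (h2 : i ≤ m+1) {w : Perm (Fin (2*m+2))}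
    (hw : w ∈ Weyl m) (h : val m w i < val m w (i-1)) :
    invCount m w = invCount m (w * sRefl m i) + 2 := by
  have e : w * sRefl m i * sRefl m i = w := by rw [mul_assoc, sRefl_mul_self h1 h2, mul_one]
  conv_lhs => rw [← e]
  apply invCount_mul_of_lt h1 h2 (mul_mem hw (sRefl_mem h1 h2))
  rw [val_mul_sRefl h1 h2 _ (by omega), val_mul_sRefl h1 h2 _ (by omega)]
  have a1 : sIdx m i i = i-1 := by unfold sIdx; split_ifs <;> omega
  have a2 : sIdx m i (i-1) = i := by unfold sIdx; split_ifs <;> omega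
  rwa [a1, a2]

lemma val_ne {m i : ℕ} (h1 : 1 ≤ i) (h2 : i ≤ m+1) (w : Perm (Fin (2*m+2))) :
    val m w (i-1) ≠ val m w i := fun h => by
  have := val_inj (by omega) (by omega) h
  omega

lemma invCount_prod_le {m : ℕ} (l : List ℕ) (hl : ∀ i ∈ l, 1 ≤ i ∧ i ≤ m+1)
    {w : Perm (Fin (2*m+2))} (hw : w ∈ Weyl m) :
    w * (l.map (sRefl m)).prod ∈ Weyl m ∧
      invCount m (w * (l.map (sRefl m)).prod) ≤ invCount m w + 2 * l.length := by
  induction l generalizing w with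
  | nil => simpa using hw
  | cons i l ih =>
    obtain ⟨h1, h2⟩ := hl i (by simp)
    have := ih (fun j hj => hl j (by simp [hj])) (mul_mem hw (sRefl_mem h1 h2))
    rw [List.map_cons, List.prod_cons, ← mul_assoc, List.length_cons]
    refine ⟨this.1, this.2.trans ?_⟩
    rcases lt_or_gt_of_ne (val_ne h1 h2 w) with h | h
    · rw [invCount_mul_of_lt h1 h2 hw h]; omega
    · have := invCount_mul_of_gt h1 h2 hw h; omega

lemma eq_self_of_increasing {f : ℕ → ℕ} {a b : ℕ} (ha : a ≤ f a) (hb : f b ≤ b)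
    (hf : ∀ p, a < p → p ≤ b → f (p-1) < f p) {p : ℕ} (hap : a ≤ p) (hpb : p ≤ b) :
    f p = p := by
  have lower : ∀ j, a + j ≤ b → a + j ≤ f (a+j) := by
    intro j
    induction j with
    | zero => exact fun _ => ha
    | succ j ih =>
      intro h
      have := hf (a+(j+1)) (by omega) h
      have e : a+(j+1)-1 = a+j := by omega
      rw [e] at this
      have := ih (by omega)
      omega
  have upper : ∀ j, j ≤ b - a → f (b-j) ≤ b-j := by
    intro j
    induction j with
    | zero => simpa using hb
    | succ j ih =>
      intro h
      have := hf (b-j) (by omega) (by omega)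
      have e : b-j-1 = b-(j+1) := by omega
      rw [e] at this
      have := ih (by omega)
      omega
  have l := lower (p-a) (by omega)
  have u := upper (b-p) (by omega)
  rw [show a+(p-a) = p by omega] at l
  rw [show b-(b-p) = p by omega] at u
  omega

/-- A signed permutation preserving the first `k` positions is a reduced product of simple
reflections other than `s_k`. -/
lemma exists_word {m k : ℕ} (hk : k ≤ m) {w : Perm (Fin (2*m+2))} (hw : w ∈ Weyl m)
    (hwk : ∀ p < k, val m w p < k) :
    ∃ l : List ℕ, (∀ i ∈ l, 1 ≤ i ∧ i ≤ m+1 ∧ i ≠ k) ∧ (l.map (sRefl m)).prod = w ∧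
      2 * l.length = invCount m w := by
  induction hN : invCount m w using Nat.strong_induction_on generalizing w with
  | _ N ih =>
  by_cases hdes : ∃ i, 1 ≤ i ∧ i ≤ m+1 ∧ i ≠ k ∧ val m w i < val m w (i-1)
  · obtain ⟨i, h1, h2, h3, h⟩ := hdes
    have hc := invCount_mul_of_gt h1 h2 hw h
    have hpres : ∀ p < k, val m (w * sRefl m i) p < k := by
      intro p hp
      rw [val_mul_sRefl h1 h2 _ (by omega)]
      apply hwk
      unfold sIdx
      split_ifs <;> omega
    obtain ⟨l, hl, hlp, hll⟩ := ih _ (by omega) (mul_mem hw (sRefl_mem h1 h2)) hpres rfl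
    refine ⟨l ++ [i], ?_, ?_, ?_⟩
    · intro j hj
      rcases List.mem_append.1 hj with hj | hj
      · exact hl j hj
      · rw [List.mem_singleton.1 hj]; exact ⟨h1, h2, h3⟩
    · rw [List.map_append, List.prod_append, hlp]
      simp [mul_assoc, sRefl_mul_self h1 h2]
    · rw [List.length_append, List.length_singleton]; omega
  · push Not at hdes
    have hasc : ∀ i, 1 ≤ i → i ≤ m+1 → i ≠ k → val m w (i-1) < val m w i :=
      fun i h1 h2 h3 => lt_of_le_of_ne (hdes i h1 h2 h3) (val_ne h1 h2 w)
    have hlow : ∀ p < k, val m w p = p := fun p hp =>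
      eq_self_of_increasing (a := 0) (b := k-1) (Nat.zero_le _)
        (by have := hwk (k-1) (by omega); omega)
        (fun q h1 h2 => hasc q h1 (by omega) (by omega)) (Nat.zero_le _) (by omega)
    have hhigh : ∀ p, k ≤ p → p ≤ m → val m w p = p := fun p hp hpm =>
      eq_self_of_increasing (a := k) (b := m)
        (by
          by_contra hcon
          have := val_inj (by omega) (by omega) (hlow (val m w k) (by omega))
          omega)
        (by
          have h1 := hasc (m+1) (by omega) le_rfl (by omega)
          have h2 := val_bar hw (show m ≤ 2*m+1 by omega)
          rw [show 2*m+1-m = m+1 by omega] at h2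
          simp only [Nat.add_sub_cancel] at h1
          omega)
        (fun q h1 h2 => hasc q (by omega) (by omega) (by omega)) hp hpm
    have hall : ∀ p ≤ m, val m w p = p := fun p hp => by
      rcases lt_or_ge p k with h | h
      exacts [hlow p h, hhigh p h hp]
    have h1 : w = 1 := by
      ext p
      have hwp : (w p : ℕ) = val m w p := by rw [val, fn_coe]
      rw [hwp, Perm.one_apply]
      rcases le_or_gt (p:ℕ) m with h | h
      · exact hall _ h
      · have := val_bar hw (show 2*m+1-(p:ℕ) ≤ 2*m+1 by omega)
        rw [show 2*m+1-(2*m+1-(p:ℕ)) = p by omega, hall (2*m+1-p) (by omega)] at this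
        omega
    refine ⟨[], by simp, by simp [h1], ?_⟩
    rw [← hN, h1, invCount_one]; rfl

lemma two_mul_len {m : ℕ} {w : Perm (Fin (2*m+2))} (hw : w ∈ Weyl m) :
    2 * len m w = invCount m w := by
  obtain ⟨l, hl, hlp, hll⟩ := exists_word (Nat.zero_le m) hw (by simp)
  have hmem : l.length ∈ {r | ∃ l : List ℕ, l.length = r ∧ (∀ i ∈ l, 1 ≤ i ∧ i ≤ m+1) ∧
      (l.map (sRefl m)).prod = w} :=
    ⟨l, rfl, fun i hi => ⟨(hl i hi).1, (hl i hi).2.1⟩, hlp⟩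
  have hle : len m w ≤ l.length := Nat.sInf_le hmem
  obtain ⟨l', hl', hr, hp⟩ := Nat.sInf_mem ⟨_, hmem⟩
  have := (invCount_prod_le l' hr (one_mem (Weyl m))).2
  rw [one_mul, hp, invCount_one, hl'] at this
  change invCount m w ≤ 0 + 2 * len m w at this
  omega

lemma len_lt_iff {m i : ℕ} (h1 : 1 ≤ i) (h2 : i ≤ m+1) {w : Perm (Fin (2*m+2))}
    (hw : w ∈ Weyl m) :
    len m w < len m (w * sRefl m i) ↔ val m w (i-1) < val m w i := by
  have e1 := two_mul_len hw
  have e2 := two_mul_len (mul_mem hw (sRefl_mem h1 h2))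
  rcases lt_or_gt_of_ne (val_ne h1 h2 w) with h | h
  · have := invCount_mul_of_lt h1 h2 hw h
    omega
  · have := invCount_mul_of_gt h1 h2 hw h
    omega

/-! ### Cosets and value sets -/

/-- The values on the first `k` positions, as natural numbers. -/
def vals (m k : ℕ) (w : Perm (Fin (2*m+2))) : Set ℕ := {x | ∃ p < k, val m w p = x}

lemma WP_le {m k : ℕ} (hk : k ≤ m) {v : Perm (Fin (2*m+2))} (hv : v ∈ WP m k) :
    v ∈ Weyl m ∧ ∀ w, vals m k (w * v) = vals m k w := by
  induction hv using Subgroup.closure_induction with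
  | mem x hx =>
    obtain ⟨i, h1, h2, h3, rfl⟩ := hx
    have hs : ∀ p < k, sIdx m i p < k := fun p hp => by unfold sIdx; split_ifs <;> omega
    refine ⟨sRefl_mem h1 h2, fun w => Set.ext fun x => ⟨?_, ?_⟩⟩
    · rintro ⟨p, hp, rfl⟩
      exact ⟨_, hs p hp, (val_mul_sRefl h1 h2 w (by omega)).symm⟩
    · rintro ⟨p, hp, rfl⟩
      have := hs p hp
      exact ⟨_, hs p hp, by rw [val_mul_sRefl h1 h2 w (by omega), sIdx_sIdx h1 h2]⟩
  | one => exact ⟨one_mem _, fun w => by rw [mul_one]⟩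
  | mul x y _ _ hx hy =>
    exact ⟨mul_mem hx.1 hy.1, fun w => by rw [← mul_assoc, hy.2, hx.2]⟩
  | inv x _ hx => exact ⟨inv_mem hx.1, fun w => by rw [← hx.2, inv_mul_cancel_right]⟩

lemma vals_eq_of_cosetEq {m k : ℕ} (hk : k ≤ m) {x y : Perm (Fin (2*m+2))}
    (h : cosetEq m k x y) : vals m k y = vals m k x := by
  have := (WP_le hk h).2 x
  rwa [mul_inv_cancel_left] at this

lemma cosetEq_of_vals_eq {m k : ℕ} (hk : k ≤ m) {x y : Perm (Fin (2*m+2))}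
    (hx : x ∈ Weyl m) (hy : y ∈ Weyl m) (h : vals m k x = vals m k y) : cosetEq m k x y := by
  have hp : ∀ p < k, val m (x⁻¹ * y) p < k := by
    intro p hp
    obtain ⟨q, hq, e⟩ : val m y p ∈ vals m k x := h ▸ ⟨p, hp, rfl⟩
    have e' : x (fn m q) = y (fn m p) := Fin.ext e
    have e'' : x⁻¹ (x (fn m q)) = fn m q := x.symm_apply_apply _
    rw [val, Perm.mul_apply, ← e', e'', fn_val (by omega)]
    exact hq
  obtain ⟨l, hl, hlp, -⟩ := exists_word hk (mul_mem (inv_mem hx) hy) hp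
  rw [cosetEq, ← hlp]
  apply Subgroup.list_prod_mem
  intro g hg
  obtain ⟨i, hi, rfl⟩ := List.mem_map.1 hg
  exact Subgroup.subset_closure ⟨i, (hl i hi).1, (hl i hi).2.1, (hl i hi).2.2, rfl⟩

lemma isMinRep.val_lt_val {m k : ℕ} {w : Perm (Fin (2*m+2))} (hw : isMinRep m k w) {i : ℕ}
    (h1 : 1 ≤ i) (h2 : i ≤ m+1) (h3 : i ≠ k) : val m w (i-1) < val m w i := by
  have hle := hw.2 _ (Subgroup.subset_closure ⟨i, h1, h2, h3, rfl⟩)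
  have e1 := two_mul_len hw.1
  have e2 := two_mul_len (mul_mem hw.1 (sRefl_mem h1 h2))
  rcases lt_or_gt_of_ne (val_ne h1 h2 w) with h | h
  · exact h
  · have := invCount_mul_of_gt h1 h2 hw.1 h
    omega

/-- A minimal representative is increasing on the first `k` positions. -/
lemma isMinRep.val_zero_le {m k : ℕ} (hk : k ≤ m) {w : Perm (Fin (2*m+2))}
    (hw : isMinRep m k w) {p : ℕ} (hp : p < k) : val m w 0 ≤ val m w p := by
  induction p with
  | zero => exact le_rfl
  | succ p ih =>
    have := hw.val_lt_val (i := p+1) (by omega) (by omega) (by omega)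
    have := ih (by omega)
    simp only [Nat.add_sub_cancel] at *
    omega

/-- A minimal representative is increasing on positions `k, …, m`. -/
lemma isMinRep.val_le_high {m k : ℕ} {w : Perm (Fin (2*m+2))}
    (hw : isMinRep m k w) {j : ℕ} (hj : k + j ≤ m) :
    val m w k ≤ val m w (k+j) ∧ val m w (k+j) ≤ val m w m := by
  constructor
  · induction j with
    | zero => exact le_rfl
    | succ j ih =>
      have := hw.val_lt_val (i := k+(j+1)) (by omega) (by omega) (by omega)
      have := ih (by omega)
      rw [show k+(j+1)-1 = k+j by omega] at *
      omega
  · obtain ⟨t, ht⟩ : ∃ t, m = k + j + t := ⟨m-(k+j), by omega⟩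
    induction t generalizing j with
    | zero => exact le_of_eq (by congr 1; omega)
    | succ t ih =>
      have := hw.val_lt_val (i := k+(j+1)) (by omega) (by omega) (by omega)
      have := ih (j := j+1) (by omega) (by omega)
      rw [show k+(j+1)-1 = k+j by omega] at *
      omega

/-- Neither `x` nor `bar x` belongs to `S`. -/
def Free (m : ℕ) (S : Set ℕ) (x : ℕ) : Prop := x ≤ 2*m+1 ∧ x ∉ S ∧ 2*m+1-x ∉ S

lemma free_vals_iff {m k : ℕ} {w : Perm (Fin (2*m+2))} (hw : w ∈ Weyl m) {x : ℕ} :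
    Free m (vals m k w) x ↔
      ∃ p, k ≤ p ∧ p ≤ m ∧ (x = val m w p ∨ x = 2*m+1 - val m w p) := by
  constructor
  · rintro ⟨h1, h2, h3⟩
    obtain ⟨p, hp, rfl⟩ := exists_val w h1
    rw [← val_bar hw hp] at h3
    have hp1 : k ≤ p := not_lt.1 fun h => h2 ⟨p, h, rfl⟩
    have hp2 : k ≤ 2*m+1-p := not_lt.1 fun h => h3 ⟨_, h, rfl⟩
    rcases le_or_gt p m with h | h
    · exact ⟨p, hp1, h, Or.inl rfl⟩
    · refine ⟨2*m+1-p, hp2, by omega, Or.inr ?_⟩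
      rw [val_bar hw hp]
      have := val_lt w p
      omega
  · rintro ⟨p, hp, hpm, h⟩
    have hl := val_lt w p
    have hb := val_bar hw (show p ≤ 2*m+1 by omega)
    have a1 : val m w p ∉ vals m k w := by
      rintro ⟨q, hq, e⟩
      have := val_inj (by omega) (by omega) e
      omega
    have a2 : 2*m+1 - val m w p ∉ vals m k w := by
      rw [← hb]
      rintro ⟨q, hq, e⟩
      have := val_inj (by omega) (by omega) e
      omega
    rcases h with rfl | rfl
    · exact ⟨by omega, a1, a2⟩
    · exact ⟨by omega, a2, by rwa [show 2*m+1-(2*m+1-val m w p) = val m w p by omega]⟩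

/-- `S` is a set of values containing no pair `x`, `bar x`. -/
def Isotropic (m : ℕ) (S : Set ℕ) : Prop := ∀ x ∈ S, x ≤ 2*m+1 ∧ 2*m+1-x ∉ S

lemma isotropic_vals {m k : ℕ} (hk : k ≤ m) {w : Perm (Fin (2*m+2))} (hw : w ∈ Weyl m) :
    Isotropic m (vals m k w) := by
  rintro x ⟨p, hp, rfl⟩
  refine ⟨by have := val_lt w p; omega, ?_⟩
  rw [← val_bar hw (by omega)]
  rintro ⟨q, hq, e⟩
  have := val_inj (by omega) (by omega) e
  omega

/-- If a minimal representative has neither `1` nor `bar 1` among its first `k` values, then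
`1` is in position `k+1` (here 0-indexed). -/
lemma isMinRep.val_eq_zero {m k : ℕ} {w : Perm (Fin (2*m+2))}
    (hw : isMinRep m k w) (h : Free m (vals m k w) 0) : val m w k = 0 := by
  obtain ⟨p, hp, hpm, h⟩ := (free_vals_iff hw.1).1 h
  obtain ⟨j, rfl⟩ := Nat.exists_eq_add_of_le hp
  have := hw.val_le_high hpm
  have h2 := val_bar hw.1 (show m ≤ 2*m+1 by omega)
  rw [show 2*m+1-m = m+1 by omega] at h2
  have h3 := hw.val_lt_val (i := m+1) (by omega) le_rfl (by omega)
  rw [Nat.add_sub_cancel] at h3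
  omega

/-! ### Hecke products along words -/

lemma hStep_mem {m i : ℕ} (h1 : 1 ≤ i) (h2 : i ≤ m+1) {w : Perm (Fin (2*m+2))}
    (hw : w ∈ Weyl m) : hStep m w i ∈ Weyl m := by
  unfold hStep
  split_ifs
  exacts [mul_mem hw (sRefl_mem h1 h2), hw]

lemma val_hStep {m i : ℕ} (h1 : 1 ≤ i) (h2 : i ≤ m) {w : Perm (Fin (2*m+2))}
    (hw : w ∈ Weyl m) :
    val m (hStep m w i) (i-1) = max (val m w (i-1)) (val m w i) ∧
    val m (hStep m w i) i = min (val m w (i-1)) (val m w i) ∧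
    ∀ p ≤ m, p ≠ i-1 → p ≠ i → val m (hStep m w i) p = val m w p := by
  have hiff := len_lt_iff h1 (show i ≤ m+1 by omega) hw
  unfold hStep
  split_ifs with h <;> rw [hiff] at h
  · rw [val_mul_sRefl h1 (by omega) _ (by omega), val_mul_sRefl h1 (by omega) _ (by omega)]
    have a1 : sIdx m i i = i-1 := by unfold sIdx; split_ifs <;> omega
    have a2 : sIdx m i (i-1) = i := by unfold sIdx; split_ifs <;> omega
    rw [a1, a2]
    refine ⟨by omega, by omega, fun p hp c1 c2 => ?_⟩
    rw [val_mul_sRefl h1 (by omega) _ (by omega)]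
    congr 1
    unfold sIdx; split_ifs <;> omega
  · exact ⟨by omega, by omega, fun _ _ _ _ => rfl⟩

lemma val_hStep_last {m : ℕ} {w : Perm (Fin (2*m+2))} (hw : w ∈ Weyl m) :
    val m (hStep m w (m+1)) m = max (val m w m) (2*m+1 - val m w m) ∧
    ∀ p < m, val m (hStep m w (m+1)) p = val m w p := by
  have hb := val_bar hw (show m ≤ 2*m+1 by omega)
  rw [show 2*m+1-m = m+1 by omega] at hb
  have hiff := len_lt_iff (show 1 ≤ m+1 by omega) le_rfl hw
  rw [Nat.add_sub_cancel] at hiff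
  unfold hStep
  split_ifs with h <;> rw [hiff] at h
  · rw [val_mul_sRefl (by omega) le_rfl _ (by omega)]
    have a1 : sIdx m (m+1) m = m+1 := by unfold sIdx; split_ifs <;> omega
    rw [a1]
    refine ⟨by omega, fun p hp => ?_⟩
    rw [val_mul_sRefl (by omega) le_rfl _ (by omega)]
    congr 1
    unfold sIdx; split_ifs <;> omega
  · exact ⟨by omega, fun _ _ => rfl⟩

lemma hWord_append (m : ℕ) (w : Perm (Fin (2*m+2))) (l l' : List ℕ) :
    hWord m w (l ++ l') = hWord m (hWord m w l) l' := List.foldl_append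

lemma hWordK_append (m k : ℕ) (w : Perm (Fin (2*m+2))) (l l' : List ℕ) :
    hWordK m k w (l ++ l') = hWordK m k (hWordK m k w l) l' := List.foldl_append

lemma hWordK_eq_hWord {m k : ℕ} (w : Perm (Fin (2*m+2))) {l : List ℕ} (hl : k ∉ l) :
    hWordK m k w l = hWord m w l := by
  induction l generalizing w with
  | nil => rfl
  | cons i l ih =>
    simp only [List.mem_cons, not_or] at hl
    change hWordK m k (hStepK m k w i) l = hWord m (hStep m w i) l
    rw [ih _ hl.2, hStepK, hStep]
    simp only [Ne.symm hl.1, or_false]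

lemma hWord_mem {m : ℕ} {w : Perm (Fin (2*m+2))} (hw : w ∈ Weyl m) {l : List ℕ}
    (hl : ∀ i ∈ l, 1 ≤ i ∧ i ≤ m+1) : hWord m w l ∈ Weyl m := by
  induction l generalizing w with
  | nil => exact hw
  | cons i l ih =>
    have hi := hl i (by simp)
    exact ih (hStep_mem hi.1 hi.2 hw) fun j hj => hl j (by simp [hj])

lemma vals_hWord {m k : ℕ} (hk : k ≤ m) (w : Perm (Fin (2*m+2))) {l : List ℕ}
    (hl : ∀ i ∈ l, 1 ≤ i ∧ i ≤ m+1 ∧ i ≠ k) : vals m k (hWord m w l) = vals m k w := by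
  induction l generalizing w with
  | nil => rfl
  | cons i l ih =>
    change vals m k (hWord m (hStep m w i) l) = _
    rw [ih _ fun j hj => hl j (by simp [hj]), hStep]
    obtain ⟨h1, h2, h3⟩ := hl i (by simp)
    split_ifs
    · exact (WP_le hk (Subgroup.subset_closure ⟨i, h1, h2, h3, rfl⟩)).2 w
    · rfl

lemma mem_ascList {a b i : ℕ} : i ∈ ascList a b ↔ a ≤ i ∧ i ≤ b := by
  rw [ascList, List.mem_range'_1]
  omega

/-- An ascending run of Hecke steps moves the smallest value to the right end. -/
lemma val_hWord_asc {m a b : ℕ} (ha : 1 ≤ a) (hab : a ≤ b+1) (hb : b ≤ m)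
    {w : Perm (Fin (2*m+2))} (hw : w ∈ Weyl m) :
    (∀ p ≤ m, p + 1 < a ∨ b < p → val m (hWord m w (ascList a b)) p = val m w p) ∧
    ∀ p, a ≤ p+1 → p ≤ b → val m (hWord m w (ascList a b)) b ≤ val m w p ∧
      ∃ q, a ≤ q+1 ∧ q ≤ b ∧ val m (hWord m w (ascList a b)) q = val m w p := by
  obtain ⟨j, rfl⟩ : ∃ j, b = a-1+j := ⟨b-(a-1), by omega⟩
  rw [ascList, show a-1+j+1-a = j by omega]
  induction j with
  | zero =>
    simp only [List.range'_zero]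
    refine ⟨fun _ _ _ => rfl, fun p h1 h2 => ?_⟩
    obtain rfl : p = a-1+0 := by omega
    exact ⟨le_rfl, _, h1, h2, rfl⟩
  | succ j ih =>
    obtain ⟨ih1, ih2⟩ := ih (by omega) (by omega)
    rw [List.range'_1_concat, hWord_append]
    have hv : hWord m w (List.range' a j) ∈ Weyl m :=
      hWord_mem hw fun i hi => by rw [List.mem_range'_1] at hi; omega
    generalize hWord m w (List.range' a j) = v at *
    obtain ⟨s1, s2, s3⟩ := val_hStep (i := a+j) (by omega) (by omega) hv
    change (∀ p ≤ m, _ → val m (hStep m v (a+j)) p = _) ∧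
      ∀ p, _ → _ → val m (hStep m v (a+j)) _ ≤ _ ∧ ∃ q, _ ∧ _ ∧ val m (hStep m v (a+j)) _ = _
    rw [show a-1+(j+1) = a+j by omega] at *
    rw [show a-1+j = a+j-1 by omega] at *
    have hlast := ih1 (a+j) (by omega) (by omega)
    refine ⟨fun p hp h => ?_, fun p h1 h2 => ?_⟩
    · rw [s3 p hp (by omega) (by omega), ih1 p hp (by omega)]
    · rcases Nat.lt_or_ge p (a+j) with h | h
      · obtain ⟨c1, q, c2, c3, c4⟩ := ih2 p h1 (by omega)
        refine ⟨by omega, ?_⟩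
        rcases Nat.lt_or_ge q (a+j-1) with h' | h'
        · exact ⟨q, c2, by omega, by rw [s3 q (by omega) (by omega) (by omega), c4]⟩
        · obtain rfl : q = a+j-1 := by omega
          rcases le_total (val m v (a+j-1)) (val m v (a+j)) with h'' | h''
          · exact ⟨a+j, by omega, le_rfl, by omega⟩
          · exact ⟨a+j-1, by omega, by omega, by omega⟩
      · obtain rfl : p = a+j := by omega
        refine ⟨by omega, ?_⟩
        rcases le_total (val m v (a+j-1)) (val m v (a+j)) with h'' | h''
        · exact ⟨a+j-1, by omega, by omega, by omega⟩
        · exact ⟨a+j, by omega, by omega, by omega⟩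

/-- A descending run of Hecke steps moves the largest value to the left end. -/
lemma val_hWord_desc {m a b : ℕ} (ha : 1 ≤ a) (hab : a ≤ b+1) (hb : b ≤ m)
    {w : Perm (Fin (2*m+2))} (hw : w ∈ Weyl m) :
    (∀ p ≤ m, p + 1 < a ∨ b < p → val m (hWord m w (ascList a b).reverse) p = val m w p) ∧
    ∀ p, a ≤ p+1 → p ≤ b → val m w p ≤ val m (hWord m w (ascList a b).reverse) (a-1) := by
  obtain ⟨j, rfl⟩ : ∃ j, b = a-1+j := ⟨b-(a-1), by omega⟩
  rw [ascList, show a-1+j+1-a = j by omega]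
  induction j generalizing w with
  | zero =>
    simp only [List.range'_zero, List.reverse_nil]
    refine ⟨fun _ _ _ => rfl, fun p h1 h2 => ?_⟩
    obtain rfl : p = a-1+0 := by omega
    exact le_rfl
  | succ j ih =>
    rw [List.range'_1_concat, List.reverse_append]
    obtain ⟨ih1, ih2⟩ := ih (hStep_mem (i := a+j) (by omega) (by omega) hw) (by omega) (by omega)
    obtain ⟨s1, s2, s3⟩ := val_hStep (i := a+j) (by omega) (by omega) hw
    change (∀ p ≤ m, _ → val m (hWord m (hStep m w (a+j)) (List.range' a j).reverse) p = _) ∧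
      ∀ p, _ → _ → _ ≤ val m (hWord m (hStep m w (a+j)) (List.range' a j).reverse) _
    generalize hWord m (hStep m w (a+j)) (List.range' a j).reverse = v at *
    refine ⟨fun p hp h => ?_, fun p h1 h2 => ?_⟩
    · rw [ih1 p hp (by omega), s3 p hp (by omega) (by omega)]
    · rcases Nat.lt_or_ge p (a+j-1) with h | h
      · have := ih2 p h1 (by omega)
        rwa [s3 p (by omega) (by omega) (by omega)] at this
      · have := ih2 (a+j-1) (by omega) (by omega)
        obtain rfl | rfl : p = a+j-1 ∨ p = a+j := by omega
        all_goals omega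

/-- The word `s_{k+1} ⋯ s_{m+1} ⋯ s_{k+1}`. -/
def midWord (m k : ℕ) : List ℕ := ascList (k+1) (m+1) ++ (ascList (k+1) m).reverse

lemma mem_midWord {m k i : ℕ} (h : i ∈ midWord m k) : k+1 ≤ i ∧ i ≤ m+1 := by
  simp only [midWord, List.mem_append, List.mem_reverse, mem_ascList] at h
  omega

lemma ascList_split {a b c : ℕ} (h1 : 1 ≤ c) (h2 : a ≤ c) (h3 : c ≤ b) :
    ascList a b = ascList a (c-1) ++ [c] ++ ascList (c+1) b := by
  obtain ⟨j, rfl⟩ := Nat.exists_eq_add_of_le h2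
  simp only [ascList]
  rw [show a+j-1+1-a = j by omega, ← List.range'_1_concat, show a+j+1 = a+(j+1) by omega,
    List.range'_append_1]
  congr 1
  omega

lemma val_hWord_midWord {m k : ℕ} (hk : k ≤ m) {w : Perm (Fin (2*m+2))} (hw : w ∈ Weyl m) :
    (∀ p < k, val m (hWord m w (midWord m k)) p = val m w p) ∧
    Free m (vals m k w) (val m (hWord m w (midWord m k)) k) ∧
    ∀ x, Free m (vals m k w) x → x ≤ val m (hWord m w (midWord m k)) k := by
  have hmem : hWord m w (midWord m k) ∈ Weyl m :=
    hWord_mem hw fun i hi => by have := mem_midWord hi; omega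
  have hvals : vals m k (hWord m w (midWord m k)) = vals m k w :=
    vals_hWord hk w fun i hi => by have := mem_midWord hi; omega
  have hfree : Free m (vals m k w) (val m (hWord m w (midWord m k)) k) := by
    rw [← hvals]
    exact (free_vals_iff hmem).2 ⟨k, le_rfl, hk, Or.inl rfl⟩
  refine ⟨?_, hfree, ?_⟩
  all_goals
    have e : midWord m k = ascList (k+1) m ++ [m+1] ++ (ascList (k+1) m).reverse := by
      rw [midWord, ascList_split (c := m+1) (by omega) (by omega) le_rfl]
      simp [ascList]
    rw [e, hWord_append, hWord_append]
    obtain ⟨a1, a2⟩ := val_hWord_asc (a := k+1) (by omega) (by omega) le_rfl hw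
    have hv : hWord m w (ascList (k+1) m) ∈ Weyl m :=
      hWord_mem hw fun i hi => by rw [mem_ascList] at hi; omega
    generalize hWord m w (ascList (k+1) m) = v at *
    obtain ⟨b1, b2⟩ := val_hStep_last hv
    have hv' := hStep_mem (i := m+1) (by omega) le_rfl hv
    change ∀ _, _
    rw [show hWord m v [m+1] = hStep m v (m+1) from rfl]
    obtain ⟨c1, c2⟩ := val_hWord_desc (a := k+1) (by omega) (by omega) le_rfl hv'
    generalize hStep m v (m+1) = v' at *
    rw [Nat.add_sub_cancel] at *
    generalize hWord m v' (ascList (k+1) m).reverse = v'' at *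
  · intro p hp
    rw [c1 p (by omega) (by omega), b2 p (by omega), a1 p (by omega) (by omega)]
  · intro x hx
    obtain ⟨p, hp, hpm, hx⟩ := (free_vals_iff hw).1 hx
    obtain ⟨d1, q, d2, d3, d4⟩ := a2 p (by omega) hpm
    have h1 := c2 m (by omega) le_rfl
    have h2 := c2 q d2 d3
    rcases Nat.lt_or_ge q m with h | h
    · rw [b2 q h] at h2
      omega
    · obtain rfl : q = m := by omega
      omega

lemma vals_mul_sRefl {m k : ℕ} (h1 : 1 ≤ k) (hk : k ≤ m) (w : Perm (Fin (2*m+2))) :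
    vals m k (w * sRefl m k) = insert (val m w k) (vals m k w \ {val m w (k-1)}) := by
  have a2 : sIdx m k (k-1) = k := by unfold sIdx; split_ifs <;> omega
  have a3 : ∀ p, p + 1 < k → sIdx m k p = p := fun p hp => by
    unfold sIdx; split_ifs <;> omega
  ext x
  simp only [Set.mem_insert_iff, Set.mem_sdiff, Set.mem_singleton_iff]
  constructor
  · rintro ⟨p, hp, rfl⟩
    rw [val_mul_sRefl h1 (by omega) _ (by omega)]
    rcases Nat.lt_or_ge (p+1) k with h | h
    · rw [a3 p h]
      refine Or.inr ⟨⟨p, hp, rfl⟩, fun e => ?_⟩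
      have := val_inj (by omega) (by omega) e
      omega
    · obtain rfl : p = k-1 := by omega
      rw [a2]; exact Or.inl rfl
  · rintro (rfl | ⟨⟨p, hp, rfl⟩, hne⟩)
    · exact ⟨k-1, by omega, by rw [val_mul_sRefl h1 (by omega) _ (by omega), a2]⟩
    · have : p ≠ k-1 := fun e => hne (by rw [e])
      exact ⟨p, hp, by rw [val_mul_sRefl h1 (by omega) _ (by omega), a3 p (by omega)]⟩

lemma val_mul_sRefl_self {m k : ℕ} (h1 : 1 ≤ k) (hk : k ≤ m) (w : Perm (Fin (2*m+2))) :
    val m (w * sRefl m k) (k-1) = val m w k ∧ val m (w * sRefl m k) k = val m w (k-1) ∧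
    ∀ p ≤ m, p ≠ k-1 → p ≠ k → val m (w * sRefl m k) p = val m w p := by
  rw [val_mul_sRefl h1 (by omega) _ (by omega), val_mul_sRefl h1 (by omega) _ (by omega)]
  refine ⟨?_, ?_, fun p hp c1 c2 => ?_⟩
  · congr 1; unfold sIdx; split_ifs <;> omega
  · congr 1; unfold sIdx; split_ifs <;> omega
  · rw [val_mul_sRefl h1 (by omega) _ (by omega)]
    congr 1; unfold sIdx; split_ifs <;> omega

/-! ### The effect of the three words on value sets -/

/-- The effect of `O_Y(1)` on value sets. -/
def RelY (m : ℕ) (S T : Set ℕ) : Prop :=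
  ∃ c, Free m S c ∧ (∀ x, Free m S x → x ≤ c) ∧ T = insert c (S \ {0})

/-- The effect of `O_Z(1)` on value sets. -/
def RelZ (m : ℕ) (S T : Set ℕ) : Prop :=
  ∃ a y, a ∈ S ∧ a ≠ 0 ∧ (∀ x ∈ S, x ≠ 0 → a ≤ x) ∧
    (Free m S y ∨ y = a ∨ y = 2*m+1-a) ∧
    (∀ x, Free m S x ∨ x = a ∨ x = 2*m+1-a → x ≤ y) ∧ T = insert y (S \ {a})

/-- The effect of `O^∘(1)` on value sets. -/
def RelF (m : ℕ) (S T : Set ℕ) : Prop :=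
  ∃ a y, a ∈ S ∧ (∀ x ∈ S, a ≤ x) ∧
    ((Free m S y ∧ y ≠ 0 ∧ y ≠ 2*m+1) ∨ y = a ∨ y = 2*m+1-a) ∧
    (∀ x, (Free m S x ∧ x ≠ 0 ∧ x ≠ 2*m+1) ∨ x = a ∨ x = 2*m+1-a → x ≤ y) ∧
    T = insert y (S \ {a})

lemma RelY.unique {m : ℕ} {S T T' : Set ℕ} (h : RelY m S T) (h' : RelY m S T') : T = T' := by
  obtain ⟨c, h1, h2, rfl⟩ := h
  obtain ⟨c', h1', h2', rfl⟩ := h'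
  rw [le_antisymm (h2' c h1) (h2 c' h1')]

lemma RelF.unique {m : ℕ} {S T T' : Set ℕ} (h : RelF m S T) (h' : RelF m S T') : T = T' := by
  obtain ⟨a, y, h1, h2, h3, h4, rfl⟩ := h
  obtain ⟨a', y', h1', h2', h3', h4', rfl⟩ := h'
  obtain rfl := le_antisymm (h2 a' h1') (h2' a h1)
  rw [le_antisymm (h4' y h3) (h4 y' h3')]

lemma RelF.eq_of_singleton {m : ℕ} {T T' : Set ℕ} (hY : RelY m {0} T) (hF : RelF m T T') :
    T' = T := by
  obtain ⟨c, h1, h2, rfl⟩ := hY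
  obtain ⟨a, y, h3, h4, h5, h6, rfl⟩ := hF
  obtain rfl : a = c := by simpa using h3
  simp only [Free, Set.mem_singleton_iff, Set.mem_insert_iff, Set.mem_sdiff] at *
  obtain rfl : y = a := by
    apply le_antisymm _ (h6 a (by omega))
    apply h2
    omega
  ext x
  simp only [Set.mem_singleton_iff, Set.mem_insert_iff, Set.mem_sdiff]
  omega

lemma free_insert_diff {m : ℕ} {S : Set ℕ} (hS : Isotropic m S) {a y : ℕ} (ha : a ∈ S)
    (hy : y ≤ 2*m+1) {x : ℕ} : Free m (insert y (S \ {a})) x ↔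
      (Free m S x ∨ x = a ∨ x = 2*m+1-a) ∧ x ≠ y ∧ x ≠ 2*m+1-y := by
  obtain ⟨h1, h2⟩ := hS a ha
  simp only [Free, Set.mem_insert_iff, Set.mem_sdiff, Set.mem_singleton_iff]
  constructor
  · rintro ⟨h3, h4, h5⟩
    refine ⟨?_, by omega, by omega⟩
    by_cases e : x = a
    · exact Or.inr (Or.inl e)
    by_cases e' : x = 2*m+1-a
    · exact Or.inr (Or.inr e')
    refine Or.inl ⟨h3, fun h => h4 (Or.inr ⟨h, e⟩), fun h => h5 (Or.inr ⟨h, by omega⟩)⟩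
  · rintro ⟨⟨h3, h4, h5⟩ | rfl | rfl, h6, h7⟩
    · exact ⟨h3, by tauto, fun h => by
        rcases h with h | h
        · omega
        · exact h5 h.1⟩
    · refine ⟨h1, by tauto, fun h => ?_⟩
      rcases h with h | h
      · omega
      · exact h2 h.1
    · have e : 2*m+1-(2*m+1-a) = a := by omega
      rw [e]
      refine ⟨by omega, by tauto, fun h => ?_⟩
      rcases h with h | h
      · omega
      · exact h.2 rfl

/-- `O_Y(1)` after `O_Z(1)` agrees with `O^∘(1)` after `O_Y(1)` on value sets. -/
lemma RelF.of_relZ_relY {m : ℕ} {S S' T T' U : Set ℕ} (hS : Isotropic m S) (h0 : 0 ∈ S)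
    (hZ : RelZ m S S') (hT' : RelY m S' T') (hT : RelY m S T) (hU : RelF m T U) : U = T' := by
  obtain ⟨c, c1, c2, rfl⟩ := hT
  obtain ⟨a, y, a1, a2, a3, y1, y2, rfl⟩ := hZ
  obtain ⟨c', c1', c2', rfl⟩ := hT'
  obtain ⟨b, z, b1, b2, z1, z2, rfl⟩ := hU
  have ha := hS a a1
  have hn0 : ¬ Free m S 0 := fun h => h.2.1 h0
  have hn1 : ¬ Free m S (2*m+1) := fun h => h.2.2 (by rwa [Nat.sub_self])
  have hna : ¬ Free m S a := fun h => h.2.1 a1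
  have hnb : ¬ Free m S (2*m+1-a) := fun h => h.2.2 (by
    rwa [show 2*m+1-(2*m+1-a) = a by omega])
  have hyl : y ≤ 2*m+1 := by
    rcases y1 with h | rfl | rfl
    exacts [h.1, ha.1, by omega]
  have hy := y2 a (Or.inr (Or.inl rfl))
  have hy' := y2 (2*m+1-a) (Or.inr (Or.inr rfl))
  have hyc := y2 c (Or.inl c1)
  have hcl := c1.1
  have hcS := c1.2.1
  have hcc := c2 (2*m+1-c) ⟨by omega, c1.2.2, by
    rw [show 2*m+1-(2*m+1-c) = c by omega]; exact c1.2.1⟩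
  simp only [free_insert_diff hS a1 hyl] at c1' c2'
  simp only [free_insert_diff hS h0 hcl] at z1 z2
  simp only [Set.mem_insert_iff, Set.mem_sdiff, Set.mem_singleton_iff] at b1 b2
  generalize Free m S = P at *
  have hca : c ≠ a := fun h => hna (h ▸ c1)
  have hca' : c ≠ 2*m+1-a := fun h => hnb (h ▸ c1)
  rcases lt_or_gt_of_ne hca with h | h
  · obtain rfl : b = c := by
      have := b2 c (Or.inl rfl)
      rcases b1 with h' | h'
      · exact h'
      · have := a3 b h'.1 h'.2
        omega
    obtain rfl : y = a := by
      rcases y1 with h' | h' | h'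
      · have := c2 y h'
        omega
      · exact h'
      · omega
    obtain rfl : c' = b := by
      refine le_antisymm ?_ (c2' b ⟨Or.inl c1, by omega, by omega⟩)
      exact c2 c' (c1'.1.resolve_right (by omega))
    obtain rfl : z = c' := by
      refine le_antisymm ?_ (z2 c' (Or.inr (Or.inl rfl)))
      rcases z1 with h' | h' | h'
      · exact c2 z (h'.1.1.resolve_right (by omega))
      · omega
      · omega
    ext x
    simp only [Set.mem_insert_iff, Set.mem_sdiff, Set.mem_singleton_iff]
    grind
  · obtain rfl : b = a := by
      have := b2 a (Or.inr ⟨a1, a2⟩)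
      rcases b1 with h' | h'
      · omega
      · exact le_antisymm this (a3 b h'.1 h'.2)
    by_cases hyc' : y = c
    · subst hyc'
      obtain rfl : z = c' := by
        apply le_antisymm
        · apply c2'
          rcases z1 with h' | h' | h'
          · exact ⟨Or.inl (h'.1.1.resolve_right (by omega)), h'.1.2⟩
          · omega
          · omega
        · apply z2
          rcases c1'.1 with h' | h' | h'
          · refine Or.inl ⟨⟨Or.inl h', c1'.2⟩, fun e => hn0 (e ▸ h'), fun e => hn1 (e ▸ h')⟩
          · omega
          · omega
      ext x
      simp only [Set.mem_insert_iff, Set.mem_sdiff, Set.mem_singleton_iff]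
      grind
    · obtain rfl : y = 2*m+1-b := by
        rcases y1 with h' | h' | h'
        · have := c2 y h'
          omega
        · omega
        · exact h'
      obtain rfl : c' = c := by
        refine le_antisymm ?_ (c2' c ⟨Or.inl c1, by omega, by omega⟩)
        exact c2 c' (c1'.1.resolve_right (by omega))
      obtain rfl : z = 2*m+1-b := by
        refine le_antisymm ?_ (z2 _ (Or.inr (Or.inr rfl)))
        rcases z1 with h' | h' | h'
        · have := c2 z (h'.1.1.resolve_right (by omega))
          omega
        · omega
        · omega
      ext x
      simp only [Set.mem_insert_iff, Set.mem_sdiff, Set.mem_singleton_iff]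
      grind

lemma low_word_aux {m k a i : ℕ} (ha : 1 ≤ a) (hk : k ≤ m)
    (hi : i ∈ ascList a (k-1)) : 1 ≤ i ∧ i ≤ m+1 ∧ i ≠ k := by
  rw [mem_ascList] at hi
  omega

lemma wordOY1_eq {m k : ℕ} (h1 : 1 ≤ k) (hk : k ≤ m) :
    wordOY1 m k = ascList 1 (k-1) ++ midWord m k ++ [k] ++ (ascList 1 (k-1)).reverse := by
  rw [wordOY1, midWord, ascList_split (a := 1) (b := m) h1 h1 hk]
  simp

lemma wordOcirc1_eq {m k : ℕ} (h1 : 1 ≤ k) (hk : k ≤ m) :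
    wordOcirc1 m =
      ascList 1 (k-1) ++ [k] ++ midWord m k ++ [k] ++ (ascList 1 (k-1)).reverse := by
  rw [wordOcirc1, midWord, ascList_split (a := 1) (b := m) h1 h1 hk,
    ascList_split (a := 1) (b := m+1) h1 h1 (by omega)]
  simp

lemma wordOZ1_eq {m k : ℕ} (h1 : 2 ≤ k) (hk : k ≤ m) :
    wordOZ1 m =
      ascList 2 (k-1) ++ [k] ++ midWord m k ++ [k] ++ (ascList 2 (k-1)).reverse := by
  rw [wordOZ1, midWord, ascList_split (a := 2) (b := m) (by omega) h1 hk,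
    ascList_split (a := 2) (b := m+1) (by omega) h1 (by omega)]
  simp

lemma midWord_mem_weyl {m k : ℕ} {w : Perm (Fin (2*m+2))} (hw : w ∈ Weyl m) :
    hWord m w (midWord m k) ∈ Weyl m :=
  hWord_mem hw fun i hi => by have := mem_midWord hi; omega

lemma vals_midWord {m k : ℕ} (hk : k ≤ m) (w : Perm (Fin (2*m+2))) :
    vals m k (hWord m w (midWord m k)) = vals m k w :=
  vals_hWord hk w fun i hi => by have := mem_midWord hi; omega

lemma val_mem_vals {m k p : ℕ} (w : Perm (Fin (2*m+2))) (hp : p < k) :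
    val m w p ∈ vals m k w := ⟨p, hp, rfl⟩

/-- The initial run of each word: the smallest value among positions `a-1, …, k-1` moves to
position `k-1`. -/
lemma initial_run {m k a : ℕ} (ha : 1 ≤ a) (hak : a ≤ k) (hk : k ≤ m)
    {w : Perm (Fin (2*m+2))} (hw : w ∈ Weyl m) :
    hWord m w (ascList a (k-1)) ∈ Weyl m ∧
    vals m k (hWord m w (ascList a (k-1))) = vals m k w ∧
    (∀ p ≤ m, p + 1 < a ∨ k ≤ p → val m (hWord m w (ascList a (k-1))) p = val m w p) ∧
    ∀ p, a ≤ p+1 → p < k → val m (hWord m w (ascList a (k-1))) (k-1) ≤ val m w p := by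
  obtain ⟨h1, h2⟩ := val_hWord_asc ha (b := k-1) (by omega) (by omega) hw
  refine ⟨hWord_mem hw fun i hi => ?_, vals_hWord hk w fun i hi => low_word_aux ha hk hi,
    fun p hp h => h1 p hp (by omega), fun p hp h => (h2 p hp (by omega)).1⟩
  have := low_word_aux ha hk hi
  omega

/-- The final run of each word does not change the value set. -/
lemma final_run {m k a : ℕ} (ha : 1 ≤ a) (hak : a ≤ k) (hk : k ≤ m)
    {w : Perm (Fin (2*m+2))} (hw : w ∈ Weyl m) :
    hWord m w (ascList a (k-1)).reverse ∈ Weyl m ∧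
    vals m k (hWord m w (ascList a (k-1)).reverse) = vals m k w ∧
    ∀ p ≤ m, p + 1 < a ∨ k ≤ p → val m (hWord m w (ascList a (k-1)).reverse) p = val m w p := by
  obtain ⟨h1, -⟩ := val_hWord_desc ha (b := k-1) (by omega) (by omega) hw
  refine ⟨hWord_mem hw fun i hi => ?_,
    vals_hWord hk w fun i hi => low_word_aux ha hk (List.mem_reverse.1 hi),
    fun p hp h => h1 p hp (by omega)⟩
  have := low_word_aux ha hk (List.mem_reverse.1 hi)
  omega

lemma mulOY1_spec {m k : ℕ} (h1 : 1 ≤ k) (hk : k ≤ m) {w : Perm (Fin (2*m+2))}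
    (hw : w ∈ Weyl m) (h0 : val m w 0 = 0) :
    mulOY1 m k w ∈ Weyl m ∧ RelY m (vals m k w) (vals m k (mulOY1 m k w)) ∧
      val m (mulOY1 m k w) k = 0 := by
  rw [mulOY1, wordOY1_eq h1 hk, hWord_append, hWord_append, hWord_append]
  obtain ⟨a1, a2, a3, a4⟩ := initial_run le_rfl h1 hk hw
  generalize hWord m w (ascList 1 (k-1)) = v at *
  have hv0 := a4 0 (by omega) (by omega)
  obtain ⟨b1, b2, b3⟩ := val_hWord_midWord hk a1
  have b4 := midWord_mem_weyl (k := k) a1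
  have b5 := vals_midWord hk v
  generalize hWord m v (midWord m k) = v' at *
  have hv0' := b1 (k-1) (by omega)
  have hpos := val_ne h1 (by omega : k ≤ m+1) v'
  have hs : hWord m v' [k] = v' * sRefl m k := by
    change hStep m v' k = _
    rw [hStep, if_pos]
    rw [len_lt_iff h1 (by omega) b4]
    omega
  rw [hs]
  have c1 := vals_mul_sRefl h1 hk v'
  have c2 := (val_mul_sRefl_self h1 hk v').2.1
  obtain ⟨d1, d2, d3⟩ := final_run le_rfl h1 hk (mul_mem b4 (sRefl_mem h1 (by omega)))
  refine ⟨d1, ⟨val m v' k, a2 ▸ b2, a2 ▸ b3, ?_⟩, ?_⟩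
  · rw [d2, c1, b5, a2, show val m v' (k-1) = 0 by omega]
  · rw [d3 k hk (Or.inr le_rfl), c2]
    omega

lemma ocirc_spec {m k : ℕ} (h1 : 1 ≤ k) (hk : k ≤ m) {w : Perm (Fin (2*m+2))}
    (hw : w ∈ Weyl m) (h0 : val m w k = 0) :
    hWordK m k w (wordOcirc1 m) ∈ Weyl m ∧
      RelF m (vals m k w) (vals m k (hWordK m k w (wordOcirc1 m))) ∧
      val m (hWordK m k w (wordOcirc1 m)) k = 0 := by
  have hstep : ∀ v : Perm (Fin (2*m+2)), hWordK m k v [k] = v * sRefl m k := fun v => by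
    change hStepK m k v k = _
    rw [hStepK, if_pos (Or.inr rfl)]
  have hm : k ∉ midWord m k := fun h => by have := mem_midWord h; omega
  have hi : k ∉ ascList 1 (k-1) := fun h => by rw [mem_ascList] at h; omega
  rw [wordOcirc1_eq h1 hk, hWordK_append, hWordK_append, hWordK_append, hWordK_append,
    hstep, hstep, hWordK_eq_hWord _ hi, hWordK_eq_hWord _ hm,
    hWordK_eq_hWord _ (by rwa [List.mem_reverse])]
  obtain ⟨a1, a2, a3, a4⟩ := initial_run le_rfl h1 hk hw
  generalize hWord m w (ascList 1 (k-1)) = v at *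
  have hvk := a3 k hk (Or.inr le_rfl)
  obtain ⟨e1, e2, e3⟩ := val_mul_sRefl_self h1 hk v
  have e4 := vals_mul_sRefl h1 hk v
  have e5 := mul_mem a1 (sRefl_mem h1 (show k ≤ m+1 by omega))
  generalize v * sRefl m k = u at *
  obtain ⟨b1, b2, b3⟩ := val_hWord_midWord hk e5
  have b4 := midWord_mem_weyl (k := k) e5
  have b5 := vals_midWord hk u
  generalize hWord m u (midWord m k) = v' at *
  have hv0' := b1 (k-1) (by omega)
  have c1 := vals_mul_sRefl h1 hk v'
  have c2 := (val_mul_sRefl_self h1 hk v').2.1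
  obtain ⟨d1, d2, d3⟩ := final_run le_rfl h1 hk (mul_mem b4 (sRefl_mem h1 (by omega)))
  have hz : val m v' (k-1) = 0 := by omega
  have hiso := isotropic_vals hk a1
  have hmem := val_mem_vals v (show k-1 < k by omega)
  have hzero : Free m (vals m k v) 0 :=
    (free_vals_iff a1).2 ⟨k, le_rfl, hk, Or.inl (by omega)⟩
  rw [e4, hvk, h0, a2] at b2 b3 b5
  rw [a2] at hiso hmem hzero
  have hbar : ∀ x, Free m (vals m k w) x ∧ x ≠ 0 ∧ x ≠ 2*m+1 ∨ x = val m v (k-1) ∨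
      x = 2*m+1 - val m v (k-1) ↔
      Free m (insert 0 (vals m k w \ {val m v (k-1)})) x := by
    intro x
    rw [free_insert_diff hiso hmem (by omega)]
    have := hiso _ hmem
    have n1 : val m v (k-1) ≠ 0 := fun e => hzero.2.1 (e ▸ hmem)
    have n2 : val m v (k-1) ≠ 2*m+1 := fun e => hzero.2.2 (by
      rw [Nat.sub_zero]; exact e ▸ hmem)
    constructor
    · rintro (⟨x1, x2, x3⟩ | x1 | x1)
      · exact ⟨Or.inl x1, x2, by omega⟩
      · omega
      · omega
    · rintro ⟨x1 | x1 | x1, x2, x3⟩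
      · exact Or.inl ⟨x1, x2, by omega⟩
      · omega
      · omega
  refine ⟨d1, ⟨val m v (k-1), val m v' k, hmem, ?_, (hbar _).2 b2,
    fun x hx => b3 x ((hbar x).1 hx), ?_⟩, ?_⟩
  · rintro x ⟨p, hp, rfl⟩
    exact a4 p (by omega) hp
  · rw [d2, c1, b5, hz]
    congr 1
    ext x
    simp only [Set.mem_insert_iff, Set.mem_sdiff, Set.mem_singleton_iff]
    have := hzero.2.1
    grind
  · rw [d3 k hk (Or.inr le_rfl), c2, hz]

lemma ozOne_spec {m k : ℕ} (h1 : 2 ≤ k) (hk : k ≤ m) {w : Perm (Fin (2*m+2))}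
    (hw : w ∈ Weyl m) (h0 : val m w 0 = 0) :
    RelZ m (vals m k w) (vals m k (hWord m w (wordOZ1 m))) := by
  rw [wordOZ1_eq h1 hk, hWord_append, hWord_append, hWord_append, hWord_append]
  obtain ⟨a1, a2, a3, a4⟩ := initial_run (a := 2) (by omega) h1 hk hw
  generalize hWord m w (ascList 2 (k-1)) = v at *
  have hv0 := a3 0 (by omega) (by omega)
  have hiso := isotropic_vals hk a1
  have hmem := val_mem_vals v (show k-1 < k by omega)
  have ha0 : val m v (k-1) ≠ 0 := fun e => by
    have := val_inj (by omega) (by omega) ((e.trans h0.symm).trans hv0.symm)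
    omega
  have hmin : ∀ x ∈ vals m k w, x ≠ 0 → val m v (k-1) ≤ x := by
    rintro x ⟨p, hp, rfl⟩ hx
    have : p ≠ 0 := fun e => hx (by rw [e, h0])
    exact a4 p (by omega) hp
  have hstep : ∀ u ∈ Weyl m, (val m u (k-1) < val m u k ∧ hWord m u [k] = u * sRefl m k) ∨
      (val m u k < val m u (k-1) ∧ hWord m u [k] = u) := by
    intro u hu
    have hiff := len_lt_iff (show 1 ≤ k by omega) (show k ≤ m+1 by omega) hu
    have hne := val_ne (show 1 ≤ k by omega) (show k ≤ m+1 by omega) u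
    change (_ ∧ hStep m u k = _) ∨ (_ ∧ hStep m u k = _)
    unfold hStep
    split_ifs with h <;> rw [hiff] at h
    · exact Or.inl ⟨h, rfl⟩
    · exact Or.inr ⟨by omega, rfl⟩
  have hfin : ∀ u ∈ Weyl m, vals m k (hWord m u (ascList 2 (k-1)).reverse) = vals m k u :=
    fun u hu => (final_run (a := 2) (by omega) h1 hk hu).2.1
  have hfree_k : Free m (vals m k w) (val m v k) := by
    rw [← a2]
    exact (free_vals_iff a1).2 ⟨k, le_rfl, hk, Or.inl rfl⟩
  have hfree_k' : Free m (vals m k w) (2*m+1 - val m v k) := by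
    rw [← a2]
    exact (free_vals_iff a1).2 ⟨k, le_rfl, hk, Or.inr rfl⟩
  have hlt := val_lt v
  rw [a2] at hiso hmem
  refine ⟨val m v (k-1), ?_⟩
  rcases hstep v a1 with ⟨hlt1, hs⟩ | ⟨hlt1, hs⟩
  · rw [hs]
    have e4 := vals_mul_sRefl (show 1 ≤ k by omega) hk v
    obtain ⟨e1, e2, e3⟩ := val_mul_sRefl_self (show 1 ≤ k by omega) hk v
    have e5 := mul_mem a1 (sRefl_mem (show 1 ≤ k by omega) (show k ≤ m+1 by omega))
    generalize v * sRefl m k = u at *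
    obtain ⟨b1, b2, b3⟩ := val_hWord_midWord hk e5
    have b4 := midWord_mem_weyl (k := k) e5
    have b5 := vals_midWord hk u
    generalize hWord m u (midWord m k) = v' at *
    have hv' := b1 (k-1) (by omega)
    rw [e4, a2] at b2 b3 b5
    have hfr : ∀ x, Free m (insert (val m v k) (vals m k w \ {val m v (k-1)})) x ↔ _ :=
      fun x => free_insert_diff hiso hmem (by have := hlt k; omega)
    have ha := hlt (k-1)
    have hb := hlt k
    have hne : val m v k ≠ 2*m+1 - val m v (k-1) := fun e => hfree_k.2.2 (by
      rwa [e, show 2*m+1 - (2*m+1 - val m v (k-1)) = val m v (k-1) by omega])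
    have hge : 2*m+1 - val m v (k-1) ≤ val m v' k := by
      apply b3
      rw [hfr]
      exact ⟨Or.inr (Or.inr rfl), by omega, by omega⟩
    have hx := (hfr _).1 b2
    have hmax : ∀ y, val m v k ≤ y → val m v' k ≤ y → ∀ x,
        Free m (vals m k w) x ∨ x = val m v (k-1) ∨ x = 2*m+1 - val m v (k-1) → x ≤ y := by
      intro y hy1 hy2 x hx'
      by_cases hb : x = val m v k
      · omega
      by_cases hb' : x = 2*m+1 - val m v k
      · omega
      have := b3 x ((hfr x).2 ⟨hx', hb, hb'⟩)
      omega
    rcases hstep v' b4 with ⟨hlt2, hs'⟩ | ⟨hlt2, hs'⟩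
    · rw [hs', hfin _ (mul_mem b4 (sRefl_mem (by omega) (by omega))),
        vals_mul_sRefl (by omega) hk v', b5, hv', e1]
      refine ⟨val m v' k, hmem, ha0, hmin, hx.1, hmax _ (by omega) le_rfl, ?_⟩
      have := hfree_k.2.1
      ext x
      simp only [Set.mem_insert_iff, Set.mem_sdiff, Set.mem_singleton_iff]
      grind
    · rw [hs', hfin _ b4, b5]
      exact ⟨val m v k, hmem, ha0, hmin, Or.inl hfree_k, hmax _ le_rfl (by omega), rfl⟩
  · rw [hs]
    obtain ⟨b1, b2, b3⟩ := val_hWord_midWord hk a1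
    have b4 := midWord_mem_weyl (k := k) a1
    have b5 := vals_midWord hk v
    generalize hWord m v (midWord m k) = v' at *
    have hv' := b1 (k-1) (by omega)
    rw [a2] at b2 b3 b5
    have hge := b3 _ hfree_k'
    have hmax : ∀ y, val m v (k-1) ≤ y → val m v' k ≤ y → ∀ x,
        Free m (vals m k w) x ∨ x = val m v (k-1) ∨ x = 2*m+1 - val m v (k-1) → x ≤ y := by
      rintro y hy1 hy2 x (hx | rfl | rfl)
      · exact (b3 x hx).trans hy2
      · exact hy1
      · omega
    rcases hstep v' b4 with ⟨hlt2, hs'⟩ | ⟨hlt2, hs'⟩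
    · rw [hs', hfin _ (mul_mem b4 (sRefl_mem (by omega) (by omega))),
        vals_mul_sRefl (by omega) hk v', b5, hv']
      exact ⟨val m v' k, hmem, ha0, hmin, Or.inl b2, hmax _ (by omega) le_rfl, rfl⟩
    · rw [hs', hfin _ b4, b5]
      refine ⟨val m v (k-1), hmem, ha0, hmin, Or.inr (Or.inl rfl), hmax _ le_rfl (by omega), ?_⟩
      rw [Set.insert_sdiff_singleton, Set.insert_eq_of_mem hmem]

lemma ozOne_mem {m : ℕ} {w : Perm (Fin (2*m+2))} (hw : w ∈ Weyl m) :
    hWord m w (wordOZ1 m) ∈ Weyl m := by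
  refine hWord_mem hw fun i hi => ?_
  simp only [wordOZ1, List.mem_append, List.mem_reverse, mem_ascList] at hi
  omega

lemma val_zero_hWord {m : ℕ} (w : Perm (Fin (2*m+2))) {l : List ℕ}
    (hl : ∀ i ∈ l, 2 ≤ i ∧ i ≤ m+1) : val m (hWord m w l) 0 = val m w 0 := by
  induction l generalizing w with
  | nil => rfl
  | cons i l ih =>
    have hi := hl i (by simp)
    change val m (hWord m (hStep m w i) l) 0 = _
    rw [ih _ fun j hj => hl j (by simp [hj]), hStep]
    split_ifs
    · rw [val_mul_sRefl (by omega) hi.2 _ (by omega)]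
      congr 1
      unfold sIdx
      split_ifs <;> omega
    · rfl

lemma val_zero_ozOne {m : ℕ} (w : Perm (Fin (2*m+2))) :
    val m (hWord m w (wordOZ1 m)) 0 = val m w 0 := by
  refine val_zero_hWord w fun i hi => ?_
  simp only [wordOZ1, List.mem_append, List.mem_reverse, mem_ascList] at hi
  omega

lemma vals_one {m : ℕ} {w : Perm (Fin (2*m+2))} (h0 : val m w 0 = 0) : vals m 1 w = {0} := by
  ext x
  constructor
  · rintro ⟨p, hp, rfl⟩
    obtain rfl : p = 0 := by omega
    exact h0
  · rintro rfl
    exact ⟨0, one_pos, h0⟩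

/-- On value sets, `O_Y(1)` after `O_Z(1)` agrees with `O^∘(1)` after `O_Y(1)`. -/
lemma vals_mulOY1_ozOne {m k : ℕ} (h1 : 1 ≤ k) (hk : k ≤ m) {w u : Perm (Fin (2*m+2))}
    (hw : w ∈ Weyl m) (h0 : val m w 0 = 0) (hu : u ∈ Weyl m) (hu0 : val m u k = 0)
    (h : vals m k u = vals m k (mulOY1 m k w)) :
    vals m k (hWordK m k u (wordOcirc1 m)) =
      vals m k (mulOY1 m k (hWord m w (wordOZ1 m))) := by
  have hY := (mulOY1_spec h1 hk hw h0).2.1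
  have h0' : val m (hWord m w (wordOZ1 m)) 0 = 0 := (val_zero_ozOne w).trans h0
  have hY' := (mulOY1_spec h1 hk (ozOne_mem hw) h0').2.1
  have hF := (ocirc_spec h1 hk hu hu0).2.1
  rw [h] at hF
  rcases h1.eq_or_lt with rfl | h2
  · rw [vals_one h0] at hY
    rw [vals_one h0'] at hY'
    rw [hF.eq_of_singleton hY, hY.unique hY']
  · exact hF.of_relZ_relY (isotropic_vals hk hw) (h0 ▸ val_mem_vals w (by omega))
      (ozOne_spec h2 hk hw h0) hY' hY

lemma mulOZ_succ (m : ℕ) (w : Perm (Fin (2*m+2))) (d : ℕ) :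
    mulOZ m w (d+1) = hWord m (mulOZ m w d) (wordOZ1 m) := by
  simp [mulOZ, wordOZ, List.replicate_succ', hWord_append]

lemma mulOcirc_add (m k : ℕ) (w : Perm (Fin (2*m+2))) (a b : ℕ) :
    mulOcirc m k w (a+b) = mulOcirc m k (mulOcirc m k w a) b := by
  simp only [mulOcirc, wordOcirc, List.replicate_add, List.flatten_append, hWordK_append]

lemma mulOcirc_succ (m k : ℕ) (w : Perm (Fin (2*m+2))) (d : ℕ) :
    mulOcirc m k w (d+1) = hWordK m k (mulOcirc m k w d) (wordOcirc1 m) := by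
  simp [mulOcirc, wordOcirc, List.replicate_succ', hWordK_append]

lemma mulOZ_spec {m : ℕ} {w : Perm (Fin (2*m+2))} (hw : w ∈ Weyl m) (h0 : val m w 0 = 0)
    (d : ℕ) : mulOZ m w d ∈ Weyl m ∧ val m (mulOZ m w d) 0 = 0 := by
  induction d with
  | zero => exact ⟨hw, h0⟩
  | succ d ih =>
    rw [mulOZ_succ, val_zero_ozOne]
    exact ⟨ozOne_mem ih.1, ih.2⟩

lemma mulOcirc_spec {m k : ℕ} (h1 : 1 ≤ k) (hk : k ≤ m) {w : Perm (Fin (2*m+2))}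
    (hw : w ∈ Weyl m) (h0 : val m w k = 0) (d : ℕ) :
    mulOcirc m k w d ∈ Weyl m ∧ val m (mulOcirc m k w d) k = 0 := by
  induction d with
  | zero => exact ⟨hw, h0⟩
  | succ d ih =>
    rw [mulOcirc_succ]
    obtain ⟨a, -, b⟩ := ocirc_spec h1 hk ih.1 ih.2
    exact ⟨a, b⟩

lemma vals_mulOcirc_congr {m k : ℕ} (h1 : 1 ≤ k) (hk : k ≤ m) {x y : Perm (Fin (2*m+2))}
    (hx : x ∈ Weyl m) (hx0 : val m x k = 0) (hy : y ∈ Weyl m) (hy0 : val m y k = 0)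
    (h : vals m k x = vals m k y) (d : ℕ) :
    vals m k (mulOcirc m k x d) = vals m k (mulOcirc m k y d) := by
  induction d with
  | zero => exact h
  | succ d ih =>
    obtain ⟨a1, a2⟩ := mulOcirc_spec h1 hk hx hx0 d
    obtain ⟨b1, b2⟩ := mulOcirc_spec h1 hk hy hy0 d
    rw [mulOcirc_succ, mulOcirc_succ]
    have := (ocirc_spec h1 hk a1 a2).2.1
    rw [ih] at this
    exact this.unique (ocirc_spec h1 hk b1 b2).2.1

lemma vals_mulOcirc_mulOY1 {m k : ℕ} (h1 : 1 ≤ k) (hk : k ≤ m) {w : Perm (Fin (2*m+2))}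
    (hw : w ∈ Weyl m) (h0 : val m w 0 = 0) (d : ℕ) :
    vals m k (mulOcirc m k (mulOY1 m k w) d) = vals m k (mulOY1 m k (mulOZ m w d)) := by
  induction d with
  | zero => rfl
  | succ d ih =>
    obtain ⟨a1, -, a2⟩ := mulOY1_spec h1 hk hw h0
    obtain ⟨b1, b2⟩ := mulOcirc_spec h1 hk a1 a2 d
    obtain ⟨c1, c2⟩ := mulOZ_spec hw h0 d
    rw [mulOcirc_succ, mulOZ_succ]
    exact vals_mulOY1_ozOne h1 hk c1 c2 b1 b2 ih

/-- For `w ∈ W^{odd} ∩ W^P` with `w(1) = 1`, `d ≥ 1` and any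
decomposition `d₁ + d₂ = d - 1`:
`(w · O_Y(d)) W_P = (((w · O_Z(d₁)) W_P · O_Y(1)) W_P ·_k O^∘(d₂)) W_P`,
where `u1` (resp. `u2`) is the minimal length representative of `(w · O_Z(d₁)) W_P`
(resp. of `(u1 · O_Y(1)) W_P`).  In particular the right-hand coset is independent of
the choice of `d₁, d₂`. -/
theorem statement8 (n k : ℕ) (hn : 1 ≤ n) (hk : 1 ≤ k) (hk' : k < n+1)
    (w : Equiv.Perm (Fin (2*n+2))) (hw : isMinRep n k w) (hwodd : isOdd n w)
    (hw1 : w (fn n 0) = fn n 0)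
    (d d1 d2 : ℕ) (hd : 1 ≤ d) (hsplit : d1 + d2 = d - 1)
    (u1 : Equiv.Perm (Fin (2*n+2))) (hu1 : isMinRep n k u1)
    (hu1c : cosetEq n k u1 (mulOZ n w d1))
    (u2 : Equiv.Perm (Fin (2*n+2))) (hu2 : isMinRep n k u2)
    (hu2c : cosetEq n k u2 (mulOY1 n k u1)) :
    cosetEq n k (mulOY n k w d) (mulOcirc n k u2 d2) := by
  have hk'' : k ≤ n := by omega
  have h0 : val n w 0 = 0 := by
    rw [val, hw1, fn_val (by omega)]
  obtain ⟨z1, z2⟩ := mulOZ_spec hw.1 h0 d1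
  obtain ⟨y1, -, y2⟩ := mulOY1_spec hk hk'' hw.1 h0
  have hz := (mulOY1_spec hk hk'' z1 z2).2.1
  have hu1v := vals_eq_of_cosetEq hk'' hu1c
  have hu10 : val n u1 0 = 0 := by
    obtain ⟨p, hp, e⟩ : 0 ∈ vals n k u1 := by
      rw [← hu1v, ← z2]
      exact val_mem_vals _ (by omega)
    have := hu1.val_zero_le hk'' hp
    omega
  obtain ⟨x1, x2, x3⟩ := mulOY1_spec hk hk'' hu1.1 hu10
  rw [← hu1v] at x2
  have hu2v := vals_eq_of_cosetEq hk'' hu2c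
  have hu2k : val n u2 k = 0 := by
    apply hu2.val_eq_zero
    rw [← hu2v, free_vals_iff x1]
    exact ⟨k, le_rfl, hk'', Or.inl x3.symm⟩
  obtain ⟨f1, f2⟩ := mulOcirc_spec hk hk'' y1 y2 d1
  have hvals : vals n k (mulOcirc n k (mulOY1 n k w) d1) = vals n k u2 := by
    rw [vals_mulOcirc_mulOY1 hk hk'' hw.1 h0, ← hu2v]
    exact hz.unique x2
  have hY : mulOY n k w d = mulOcirc n k (mulOcirc n k (mulOY1 n k w) d1) d2 := by
    rw [← mulOcirc_add, hsplit]
    rfl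
  rw [hY]
  exact cosetEq_of_vals_eq hk'' (mulOcirc_spec hk hk'' f1 f2 d2).1
    (mulOcirc_spec hk hk'' hu2.1 hu2k d2).1
    (vals_mulOcirc_congr hk hk'' f1 f2 hu2.1 hu2k hvals d2)

end
end OddSymplectic
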